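/- Let f ∈ C_0(ℝ^d), F(γ) := e^{⟨f,γ⟩}, and ε > 0. Then ∫_Γ (H_ε^− F)(γ)² μ(dγ) = ∫_{ℝ^d} z dx ∫_{ℝ^d} dy_1 ∫_{ℝ^d} dy_2 (e^{f(x)}−1)² a(y_1) a(y_2) ∫_Γ exp[(2s−1)E(x,γ) + (s−1)E(y_1/ε + x, γ) + (s−1)E(y_2/ε + x, γ) + ⟨2f,γ⟩] μ(dγ) + ∫_{ℝ^d} z dx_1 ∫_{ℝ^d} z dx_2 ∫_{ℝ^d} dy_1 ∫_{ℝ^d} dy_2 e^{f(x_1)}(e^{f(x_1)}−1) e^{f(x_2)}(e^{f(x_2)}−1) a(y_1) a(y_2) exp[(2s−1)φ(x_1−x_2) + (s−1)φ(y_1/ε + x_1 − x_2) + (s−1)φ(y_2/ε + x_2 − x_1)] ∫_Γ exp[(s−1)E(x_1,γ) + (s−1)E(x_2,γ) + (s−1)E(y_1/ε + x_1, γ) + (s−1)E(y_2/ε + x_2, γ) + ⟨2f,γ⟩] μ(dγ). -/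

import Mathlib

open MeasureTheory Set Filter
open scoped ENNReal NNReal BigOperators Topology Classical

noncomputable section

abbrev EucSp (d : ℕ) := EuclideanSpace ℝ (Fin d)

/-- The configuration space `Γ` over `ℝ^d`: locally finite subsets. -/
def Config (d : ℕ) : Type :=
  {γ : Set (EucSp d) // ∀ Λ : Set (EucSp d), IsCompact Λ → (γ ∩ Λ).Finite}

/-- The σ-algebra on `Γ` generated by the maps `γ ↦ |γ ∩ B|`, `B` Borel. -/
instance Config.instMS (d : ℕ) : MeasurableSpace (Config d) :=
  ⨆ (B : Set (EucSp d)) (_ : MeasurableSet B),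
    MeasurableSpace.comap (fun γ : Config d => (γ.1 ∩ B).encard) (⊤ : MeasurableSpace ℕ∞)

/-- `γ ∪ {x}`. -/
def Config.ins {d : ℕ} (γ : Config d) (x : EucSp d) : Config d :=
  ⟨insert x γ.1, fun Λ hΛ => ((γ.2 Λ hΛ).insert x).subset fun y hy => by
    rcases hy with ⟨h1, h2⟩
    rcases h1 with rfl | h1
    · exact Set.mem_insert _ _
    · exact Set.mem_insert_of_mem _ ⟨h1, h2⟩⟩

/-- `γ ∖ {x}`. -/
def Config.del {d : ℕ} (γ : Config d) (x : EucSp d) : Config d :=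
  ⟨γ.1 \ {x}, fun Λ hΛ => (γ.2 Λ hΛ).subset fun y hy => ⟨hy.1.1, hy.2⟩⟩

/-- The pairing `⟨f, γ⟩ = ∑_{x ∈ γ} f x`. -/
def cpair {d : ℕ} (f : EucSp d → ℝ) (γ : Config d) : ℝ := ∑' x : γ.1, f x.1

/-- `exp : [-∞,∞] → [0,∞]`. -/
def eexp (x : EReal) : ℝ≥0∞ :=
  if x = ⊤ then ⊤ else if x = ⊥ then 0 else ENNReal.ofReal (Real.exp x.toReal)

/-- real-valued exponential of an extended real (with `exp(±∞)` sent to junk value `0`). -/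
def rexp (x : EReal) : ℝ := (eexp x).toReal

/-- The relative energy `E(x,γ) = ∑_{y ∈ γ} φ(x-y)` if absolutely convergent, `+∞` otherwise. -/
def energy {d : ℕ} (φ : EucSp d → EReal) (x : EucSp d) (γ : Set (EucSp d)) : EReal :=
  if (∀ y ∈ γ, φ (x - y) ≠ ⊤) ∧ Summable (fun y : γ => (φ (x - y.1)).toReal)
  then (((∑' y : γ, (φ (x - y.1)).toReal) : ℝ) : EReal)
  else ⊤

/-- `∑_{u ∈ γ} φ(u)` if absolutely convergent, `+∞` otherwise. -/
def totPhi {d : ℕ} (φ : EucSp d → EReal) (γ : Set (EucSp d)) : EReal :=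
  if (∀ y ∈ γ, φ y ≠ ⊤) ∧ Summable (fun y : γ => (φ y.1).toReal)
  then (((∑' y : γ, (φ y.1).toReal) : ℝ) : EReal)
  else ⊤

/-- A pair potential: Borel, even, with `φ(x) ∈ ℝ` off the origin. -/
structure IsPairPotential {d : ℕ} (φ : EucSp d → EReal) : Prop where
  meas : Measurable φ
  even : ∀ x : EucSp d, x ≠ 0 → φ (-x) = φ x
  finite_off : ∀ x : EucSp d, x ≠ 0 → φ x ≠ ⊤
  ne_bot : ∀ x, φ x ≠ ⊥

/-- Stability (S): `∑_{{x,y} ⊆ η} φ(x-y) ≥ -B|η|` for all finite `η`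
(stated with the sum over ordered pairs, which doubles both sides). -/
def Stable {d : ℕ} (φ : EucSp d → EReal) (B : ℝ) : Prop :=
  ∀ η : Finset (EucSp d),
    ((-(2 * B * η.card) : ℝ) : EReal) ≤ ∑ p ∈ η.offDiag, φ (p.1 - p.2)

/-- Low activity–high temperature (LA-HT): `∫ |e^{-φ} - 1| z dx < (2 e^{1+2B})⁻¹`. -/
def LAHT {d : ℕ} (φ : EucSp d → EReal) (z B : ℝ) : Prop :=
  ∫⁻ x : EucSp d, ENNReal.ofReal (|rexp (-(φ x)) - 1| * z)
    < ENNReal.ofReal (2 * Real.exp (1 + 2 * B))⁻¹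

/-- The Georgii–Nguyen–Zessin identity characterizing `μ ∈ G(z,φ)`. -/
def GNZ {d : ℕ} (z : ℝ) (φ : EucSp d → EReal) (μ : Measure (Config d)) : Prop :=
  ∀ F : Config d → EucSp d → ℝ≥0∞,
    Measurable (Function.uncurry F) →
    ∫⁻ γ, ∑' x : γ.1, F γ x.1 ∂μ
      = ∫⁻ γ, ∫⁻ x, ENNReal.ofReal z * eexp (-(energy φ x γ.1)) * F (γ.ins x) x ∂volume ∂μ


/-- Ordered `n`-tuples of distinct points of `γ`. -/
def injTuples {d : ℕ} (n : ℕ) (γ : Set (EucSp d)) : Set (Fin n → EucSp d) :=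
  {p | Function.Injective p ∧ ∀ i, p i ∈ γ}

/-- `(k_μ^{(n)})` is the family of correlation functions of `μ`: each `k n` is measurable,
nonnegative and symmetric, and for every measurable symmetric `f : (ℝ^d)^n → [0,∞]`,
`∫_Γ ∑_{{x_1,…,x_n} ⊆ γ} f dμ = (1/n!) ∫ f·kₙ dx` (stated equivalently via the sum over
ordered tuples of distinct points, which absorbs the factor `1/n!`). -/
def HasCorrFns {d : ℕ} (μ : Measure (Config d)) (k : ∀ n : ℕ, (Fin n → EucSp d) → ℝ) : Prop :=
  (∀ n : ℕ, Measurable (k n) ∧ (∀ x, 0 ≤ k n x) ∧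
      ∀ (σ : Equiv.Perm (Fin n)) (x : Fin n → EucSp d), k n (x ∘ σ) = k n x) ∧
  ∀ n : ℕ, 0 < n → ∀ f : (Fin n → EucSp d) → ℝ≥0∞, Measurable f →
    (∀ (σ : Equiv.Perm (Fin n)) (x : Fin n → EucSp d), f (x ∘ σ) = f x) →
    ∫⁻ γ, ∑' p : injTuples n γ.1, f p.1 ∂μ
      = ∫⁻ x : Fin n → EucSp d, f x * ENNReal.ofReal (k n x)

/-- The Ruelle bound `k^{(n)} ≤ ξⁿ`. -/
def RuelleBound {d : ℕ} (k : ∀ n : ℕ, (Fin n → EucSp d) → ℝ) (ξ : ℝ) : Prop :=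
  ∀ n : ℕ, 0 < n → ∀ x : Fin n → EucSp d, k n x ≤ ξ ^ n

/-- Translation invariance of a family of functions on tuples. -/
def TransInvFns {d : ℕ} (k : ∀ n : ℕ, (Fin n → EucSp d) → ℝ) : Prop :=
  ∀ (n : ℕ) (a : EucSp d) (x : Fin n → EucSp d), k n (fun i => x i + a) = k n x

/-- `P` is a partition of `{0,…,n-1}` into nonempty pairwise disjoint blocks. -/
def IsPartOfUniv {n : ℕ} (P : Finset (Finset (Fin n))) : Prop :=
  (∀ b ∈ P, b.Nonempty) ∧ (P : Set (Finset (Fin n))).PairwiseDisjoint id ∧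
    P.sup id = Finset.univ

/-- `u` is the family of Ursell functions of `k`:
`k(η) = ∑ u(η_1) ⋯ u(η_j)`, summing over all partitions of `η`. -/
def IsUrsell {d : ℕ} (k u : ∀ n : ℕ, (Fin n → EucSp d) → ℝ) : Prop :=
  ∀ n : ℕ, 0 < n → ∀ x : Fin n → EucSp d,
    k n x = ∑ P : Finset (Finset (Fin n)),
      if IsPartOfUniv P then ∏ b ∈ P, u b.card (fun i => x (b.orderIsoOfFin rfl i).1) else 0

/-- `f ∈ C_0(ℝ^d)`: continuous with compact support. -/
def IsC0 {d : ℕ} (f : EucSp d → ℝ) : Prop := Continuous f ∧ HasCompactSupport f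

/-- Cylinder functions `FC_b(C_0(ℝ^d),Γ)`. -/
def Cyl {d : ℕ} (F : Config d → ℝ) : Prop :=
  ∃ (N : ℕ) (f : Fin N → EucSp d → ℝ) (g : (Fin N → ℝ) → ℝ),
    (∀ i, IsC0 (f i)) ∧ Continuous g ∧ (∃ C, ∀ y, |g y| ≤ C) ∧
    ∀ γ, F γ = g fun i => cpair (f i) γ

/-- `(D_x^- F)(γ) = F(γ∖x) - F(γ)`. -/
def Dminus {d : ℕ} (F : Config d → ℝ) (x : EucSp d) (γ : Config d) : ℝ := F (γ.del x) - F γ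

/-- `(D_x^+ F)(γ) = F(γ∪x) - F(γ)`. -/
def Dplus {d : ℕ} (F : Config d → ℝ) (x : EucSp d) (γ : Config d) : ℝ := F (γ.ins x) - F γ

/-- `(D_{xy}^{-+} F)(γ) = F(γ∖x∪y) - F(γ)`. -/
def Dpm {d : ℕ} (F : Config d → ℝ) (x y : EucSp d) (γ : Config d) : ℝ :=
  F ((γ.del x).ins y) - F γ

/-- The Glauber bilinear form `E_G`. -/
def glauberForm {d : ℕ} (s : ℝ) (φ : EucSp d → EReal) (μ : Measure (Config d))
    (F G : Config d → ℝ) : ℝ :=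
  ∫ γ, (∑' x : γ.1,
      rexp ((s : EReal) * energy φ x.1 (γ.1 \ {x.1})) * Dminus F x.1 γ * Dminus G x.1 γ) ∂μ

/-- The Kawasaki bilinear form `E_K`. -/
def kawasakiForm {d : ℕ} (s : ℝ) (a : EucSp d → ℝ) (φ : EucSp d → EReal)
    (μ : Measure (Config d)) (F G : Config d → ℝ) : ℝ :=
  (1 / 2) * ∫ γ, (∑' x : γ.1, ∫ y : EucSp d,
      a (x.1 - y) *
        rexp ((s : EReal) * energy φ x.1 (γ.1 \ {x.1}) +
          ((s - 1 : ℝ) : EReal) * energy φ y (γ.1 \ {x.1})) *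
        Dpm F x.1 y γ * Dpm G x.1 y γ) ∂μ

/-- The Glauber generator `H_G`. -/
def HG {d : ℕ} (s z : ℝ) (φ : EucSp d → EReal) (F : Config d → ℝ) (γ : Config d) : ℝ :=
  -(∑' x : γ.1, rexp ((s : EReal) * energy φ x.1 (γ.1 \ {x.1})) * Dminus F x.1 γ)
    - ∫ x : EucSp d, z * rexp (((s - 1 : ℝ) : EReal) * energy φ x γ.1) * Dplus F x γ

/-- The Kawasaki generator `H_K`. -/
def HK {d : ℕ} (s : ℝ) (a : EucSp d → ℝ) (φ : EucSp d → EReal) (F : Config d → ℝ)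
    (γ : Config d) : ℝ :=
  -(∑' x : γ.1, ∫ y : EucSp d,
      a (x.1 - y) * rexp ((s : EReal) * energy φ x.1 (γ.1 \ {x.1}) +
        ((s - 1 : ℝ) : EReal) * energy φ y (γ.1 \ {x.1})) * Dpm F x.1 y γ)

/-- The scaled jump kernel `a_ε(x) = ε^d a(ε x)`. -/
def aScaled {d : ℕ} (a : EucSp d → ℝ) (ε : ℝ) (x : EucSp d) : ℝ := ε ^ d * a (ε • x)

/-- `H_ε^-` (death part of the Kawasaki generator with kernel `aa`). -/
def HepsMinus {d : ℕ} (s : ℝ) (aa : EucSp d → ℝ) (φ : EucSp d → EReal)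
    (F : Config d → ℝ) (γ : Config d) : ℝ :=
  -(∑' x : γ.1, Dminus F x.1 γ * ∫ y : EucSp d,
      aa (x.1 - y) * rexp ((s : EReal) * energy φ x.1 (γ.1 \ {x.1}) +
        ((s - 1 : ℝ) : EReal) * energy φ y (γ.1 \ {x.1})))

/-- `H_ε^+` (birth part of the Kawasaki generator with kernel `aa`). -/
def HepsPlus {d : ℕ} (s : ℝ) (aa : EucSp d → ℝ) (φ : EucSp d → EReal)
    (F : Config d → ℝ) (γ : Config d) : ℝ :=
  -(∑' x : γ.1, ∫ y : EucSp d,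
      aa (x.1 - y) * rexp ((s : EReal) * energy φ x.1 (γ.1 \ {x.1}) +
        ((s - 1 : ℝ) : EReal) * energy φ y (γ.1 \ {x.1})) * Dplus F y (γ.del x.1))

/-- `H_0^-` (death part of the Glauber generator). -/
def H0Minus {d : ℕ} (s : ℝ) (φ : EucSp d → EReal) (F : Config d → ℝ) (γ : Config d) : ℝ :=
  -(∑' x : γ.1, rexp ((s : EReal) * energy φ x.1 (γ.1 \ {x.1})) * Dminus F x.1 γ)

/-- `H_0^+` (birth part of the Glauber generator). -/
def H0Plus {d : ℕ} (s z : ℝ) (φ : EucSp d → EReal) (F : Config d → ℝ) (γ : Config d) : ℝ :=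
  -∫ x : EucSp d, z * rexp (((s - 1 : ℝ) : EReal) * energy φ x γ.1) * Dplus F x γ

/-- The standing assumptions of the paper: `s ∈ [0,1/2]`, a stable pair potential in the
low activity–high temperature regime, bounded outside a ball, and `μ` the Gibbs measure
from Ruelle's theorem with its correlation and Ursell functions. -/
structure Setting (d : ℕ) (s z B ξ : ℝ) (φ : EucSp d → EReal) (μ : Measure (Config d))
    (k u : ∀ n : ℕ, (Fin n → EucSp d) → ℝ) : Prop where
  hd : 0 < d
  hs0 : 0 ≤ s
  hs1 : s ≤ 1 / 2
  pp : IsPairPotential φ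
  hB : 0 ≤ B
  stable : Stable φ B
  hz : 0 < z
  laht : LAHT φ z B
  bddOutside : ∃ R C : ℝ, ∀ x : EucSp d, R ≤ ‖x‖ → ∃ r : ℝ, φ x = (r : EReal) ∧ |r| ≤ C
  prob : IsProbabilityMeasure μ
  gnz : GNZ z φ μ
  corr : HasCorrFns μ k
  ti : TransInvFns k
  hξ : 0 < ξ
  ruelle : RuelleBound k ξ
  ursell : IsUrsell k u
  ursellInt : ∀ m : ℕ,
    Integrable (fun y : Fin (m + 1) → EucSp d => u (m + 2) (Fin.cons 0 y)) volume

/-- The jump kernel `a`: bounded, nonnegative, even, integrable. -/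
structure GoodA {d : ℕ} (a : EucSp d → ℝ) : Prop where
  meas : Measurable a
  nonneg : ∀ x, 0 ≤ a x
  bdd : ∃ C, ∀ x, a x ≤ C
  even : ∀ x, a (-x) = a x
  int : Integrable a volume

/-- `φ(x) → 0` as `|x| → ∞`. -/
def PhiVanishes {d : ℕ} (φ : EucSp d → EReal) : Prop :=
  Tendsto φ (cocompact (EucSp d)) (nhds (0 : EReal))

/-- The normalization `∫ a dx = (∫_Γ exp[(s-1) ∑_{u∈γ} φ(u)] dμ(γ))⁻¹`. -/
def NormalizedA {d : ℕ} (s : ℝ) (a : EucSp d → ℝ) (φ : EucSp d → EReal)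
    (μ : Measure (Config d)) : Prop :=
  (∫ x : EucSp d, a x) = (∫ γ, rexp (((s - 1 : ℝ) : EReal) * totPhi φ γ.1) ∂μ)⁻¹


section Measurability

variable {d : ℕ} {Ω : Type*} [MeasurableSpace Ω]

lemma Config.measurable_encard {B : Set (EucSp d)} (hB : MeasurableSet B) :
    Measurable fun γ : Config d => ((γ.1 ∩ B).encard : ℝ≥0∞) := by
  have h : Measurable[Config.instMS d, ⊤] fun γ : Config d => (γ.1 ∩ B).encard :=
    fun s hs => (le_iSup₂ (f := fun (B : Set (EucSp d)) (_ : MeasurableSet B) =>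
      MeasurableSpace.comap (fun γ : Config d => (γ.1 ∩ B).encard) (⊤ : MeasurableSpace ℕ∞))
        B hB) _ ⟨s, hs, rfl⟩
  exact @Measurable.comp _ _ _ _ ⊤ _ (fun n : ℕ∞ => (n : ℝ≥0∞)) _ measurable_from_top h

lemma Config.measurable_of_encard {g : Ω → Config d}
    (h : ∀ B : Set (EucSp d), MeasurableSet B →
      Measurable fun ω => (((g ω).1 ∩ B).encard : ℝ≥0∞)) : Measurable g := by
  rw [measurable_iff_comap_le, Config.instMS]
  simp only [MeasurableSpace.comap_iSup, MeasurableSpace.comap_comp]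
  refine iSup₂_le fun B hB => ?_
  rintro _ ⟨s, -, rfl⟩
  have h1 : MeasurableSet ((fun n : ℕ∞ => (n : ℝ≥0∞)) '' s) :=
    ((Set.to_countable s).image _).measurableSet
  have h2 := h B hB h1
  convert! h2 using 1
  ext ω
  simp

/-- The counting measure of a configuration. -/
def Config.toMeasure (γ : Config d) : Measure (EucSp d) :=
  Measure.sum fun y : γ.1 => Measure.dirac y.1

lemma Config.lintegral_toMeasure (γ : Config d) (h : EucSp d → ℝ≥0∞) :
    ∫⁻ y, h y ∂γ.toMeasure = ∑' y : γ.1, h y.1 := by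
  simp [Config.toMeasure, lintegral_sum_measure]

lemma Config.toMeasure_apply (γ : Config d) {B : Set (EucSp d)} (hB : MeasurableSet B) :
    γ.toMeasure B = (γ.1 ∩ B).encard := by
  rw [← lintegral_indicator_one hB, Config.lintegral_toMeasure,
    tsum_subtype γ.1 (B.indicator 1), Set.indicator_indicator, ← tsum_subtype, ← ENNReal.tsum_set_one]
  rfl

lemma Config.measurable_toMeasure : Measurable (Config.toMeasure : Config d → Measure (EucSp d)) := by
  refine Measure.measurable_of_measurable_coe _ fun B hB => ?_
  simp only [Config.toMeasure_apply _ hB]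
  exact Config.measurable_encard hB

lemma Config.measurable_toMeasure_section {g : Ω → Config d} (hg : Measurable g)
    {t : Set (Ω × EucSp d)} (ht : MeasurableSet t) :
    Measurable fun ω => (g ω).toMeasure (Prod.mk ω ⁻¹' t) := by
  let κ : ProbabilityTheory.Kernel Ω (EucSp d) :=
    ⟨fun ω => (g ω).toMeasure, Config.measurable_toMeasure.comp hg⟩
  have hball : ∀ n : ℕ, MeasurableSet (Metric.closedBall (0 : EucSp d) n) :=
    fun n => measurableSet_closedBall
  have hfin : ∀ n : ℕ, Measurable fun ω =>
      (κ.restrict (hball n)) ω (Prod.mk ω ⁻¹' t) := fun n => by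
    refine ProbabilityTheory.Kernel.measurable_kernel_prodMk_left_of_finite ht fun ω => ⟨?_⟩
    rw [ProbabilityTheory.Kernel.restrict_apply, Measure.restrict_apply_univ]
    change (g ω).toMeasure _ < ⊤
    rw [Config.toMeasure_apply _ (hball n)]
    have := (g ω).2 _ (isCompact_closedBall (0 : EucSp d) (n : ℝ))
    exact ENat.toENNReal_lt_top.2 this.encard_lt_top
  have : (fun ω => (g ω).toMeasure (Prod.mk ω ⁻¹' t)) = fun ω =>
      ⨆ n : ℕ, (κ.restrict (hball n)) ω (Prod.mk ω ⁻¹' t) := by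
    ext ω
    have h1 : Prod.mk ω ⁻¹' t = ⋃ n : ℕ, Prod.mk ω ⁻¹' t ∩ Metric.closedBall (0 : EucSp d) n := by
      rw [← Set.inter_iUnion, Metric.iUnion_closedBall_nat, Set.inter_univ]
    conv_lhs => rw [h1]
    rw [Monotone.measure_iUnion]
    · refine iSup_congr fun n => ?_
      rw [ProbabilityTheory.Kernel.restrict_apply,
        Measure.restrict_apply (measurable_prodMk_left ht)]
      rfl
    · intro m n hmn
      exact Set.inter_subset_inter_right _ (Metric.closedBall_subset_closedBall (by exact_mod_cast hmn))
  rw [this]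
  exact Measurable.iSup hfin

/-- Sums over the points of a measurably varying configuration depend measurably on
the parameter. -/
lemma Config.measurable_tsum {g : Ω → Config d} (hg : Measurable g)
    {h : Ω → EucSp d → ℝ≥0∞} (hh : Measurable (Function.uncurry h)) :
    Measurable fun ω => ∑' y : (g ω).1, h ω y.1 := by
  simp only [← Config.lintegral_toMeasure]
  suffices ∀ H : Ω × EucSp d → ℝ≥0∞, Measurable H →
      Measurable fun ω => ∫⁻ y, H (ω, y) ∂(g ω).toMeasure from this _ hh
  intro H hH
  refine Measurable.ennreal_induction (motive := fun H : Ω × EucSp d → ℝ≥0∞ =>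
    Measurable fun ω => ∫⁻ y, H (ω, y) ∂(g ω).toMeasure) ?_ ?_ ?_ hH
  · intro c s hs
    have : ∀ ω, ∫⁻ y, s.indicator (fun _ => c) (ω, y) ∂(g ω).toMeasure
        = c * (g ω).toMeasure (Prod.mk ω ⁻¹' s) := fun ω => by
      rw [← lintegral_indicator_const (measurable_prodMk_left hs)]
      rfl
    simp only [this]
    exact (Config.measurable_toMeasure_section hg hs).const_mul c
  · intro f₁ f₂ _ hf₁ hf₂ h₁ h₂
    have : ∀ ω, ∫⁻ y, (f₁ + f₂) (ω, y) ∂(g ω).toMeasure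
        = ∫⁻ y, f₁ (ω, y) ∂(g ω).toMeasure + ∫⁻ y, f₂ (ω, y) ∂(g ω).toMeasure := fun ω =>
      lintegral_add_left (hf₁.comp measurable_prodMk_left) _
    simp only [this]
    exact h₁.add h₂
  · intro f hf hmono hind
    have : ∀ ω, ∫⁻ y, ⨆ n, f n (ω, y) ∂(g ω).toMeasure
        = ⨆ n, ∫⁻ y, f n (ω, y) ∂(g ω).toMeasure := fun ω =>
      lintegral_iSup (fun n => (hf n).comp measurable_prodMk_left)
        fun m n hmn y => hmono hmn (ω, y)
    simp only [this]
    exact Measurable.iSup hind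

lemma Config.countable (γ : Config d) : γ.1.Countable := by
  have : γ.1 = ⋃ n : ℕ, γ.1 ∩ Metric.closedBall (0 : EucSp d) n := by
    rw [← Set.inter_iUnion, Metric.iUnion_closedBall_nat, Set.inter_univ]
  rw [this]
  exact Set.countable_iUnion fun n => (γ.2 _ (isCompact_closedBall _ _)).countable

lemma Config.measurableSet_mem : MeasurableSet {p : Config d × EucSp d | p.2 ∈ p.1.1} := by
  have h : Measurable fun p : Config d × EucSp d =>
      ∑' y : p.1.1, if y.1 = p.2 then (1 : ℝ≥0∞) else 0 :=
    Config.measurable_tsum measurable_fst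
      (h := fun (p : Config d × EucSp d) y => if y = p.2 then (1 : ℝ≥0∞) else 0)
      (Measurable.ite (measurableSet_eq_fun measurable_snd measurable_fst.snd)
        measurable_const measurable_const)
  have h2 := h (measurableSet_singleton 0).compl
  convert! h2 using 1
  ext ⟨γ, x⟩
  simp [ENNReal.tsum_eq_zero]

lemma Config.measurable_ins :
    Measurable fun p : Config d × EucSp d => p.1.ins p.2 := by
  refine Config.measurable_of_encard fun B hB => ?_
  have : (fun p : Config d × EucSp d => (((p.1.ins p.2).1 ∩ B).encard : ℝ≥0∞)) =
      fun p => ((p.1.1 ∩ B).encard : ℝ≥0∞) + if p.2 ∈ B ∧ ¬ p.2 ∈ p.1.1 then 1 else 0 := by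
    ext ⟨γ, x⟩
    simp only [Config.ins]
    split_ifs with h
    · rw [Set.insert_inter_of_mem h.1, Set.encard_insert_of_notMem (fun h' => h.2 h'.1)]
      simp
    · rw [add_zero]
      congr 2
      by_cases hx : x ∈ B
      · rw [Set.insert_eq_of_mem (by tauto)]
      · rw [Set.insert_inter_of_notMem hx]
  rw [this]
  refine ((Config.measurable_encard hB).comp measurable_fst).add (Measurable.ite ?_ measurable_const
    measurable_const)
  exact (measurable_snd hB).inter Config.measurableSet_mem.compl

lemma Config.measurable_del :
    Measurable fun p : Config d × EucSp d => p.1.del p.2 := by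
  refine Config.measurable_of_encard fun B hB => ?_
  have : (fun p : Config d × EucSp d => (((p.1.del p.2).1 ∩ B).encard : ℝ≥0∞)) =
      fun p => ∑' y : p.1.1, if y.1 ∈ B ∧ y.1 ≠ p.2 then (1 : ℝ≥0∞) else 0 := by
    ext ⟨γ, x⟩
    simp only
    rw [tsum_subtype γ.1 (fun y => if y ∈ B ∧ y ≠ x then (1 : ℝ≥0∞) else 0),
      ← ENNReal.tsum_set_one, tsum_subtype ((γ.del x).1 ∩ B) (fun _ => (1 : ℝ≥0∞))]
    refine tsum_congr fun y => ?_
    simp only [Set.indicator_apply, Config.del, Set.mem_inter_iff, Set.mem_sdiff,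
      Set.mem_singleton_iff, ne_eq]
    split_ifs <;> tauto
  rw [this]
  refine Config.measurable_tsum measurable_fst
    (h := fun (p : Config d × EucSp d) y => if y ∈ B ∧ y ≠ p.2 then (1 : ℝ≥0∞) else 0) ?_
  refine Measurable.ite ?_ measurable_const measurable_const
  exact (measurable_snd hB).inter
    (measurableSet_eq_fun measurable_snd measurable_fst.snd).compl

lemma Summable.tsum_eq_toReal_sub {ι : Type*} {g : ι → ℝ} (hg : Summable g) :
    ∑' i, g i = (∑' i, ENNReal.ofReal (g i)).toReal - (∑' i, ENNReal.ofReal (-g i)).toReal := by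
  have h1 : Summable fun i => max (g i) 0 :=
    Summable.of_nonneg_of_le (fun i => le_max_right _ _)
      (fun i => max_le (le_abs_self _) (abs_nonneg _)) hg.abs
  have h2 : Summable fun i => max (-g i) 0 :=
    Summable.of_nonneg_of_le (fun i => le_max_right _ _)
      (fun i => max_le (neg_le_abs _) (abs_nonneg _)) hg.abs
  have e1 : ∀ i, ENNReal.ofReal (g i) = ENNReal.ofReal (max (g i) 0) := fun i => by
    rw [ENNReal.ofReal_max, ENNReal.ofReal_zero, max_eq_left zero_le]
  have e2 : ∀ i, ENNReal.ofReal (-g i) = ENNReal.ofReal (max (-g i) 0) := fun i => by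
    rw [ENNReal.ofReal_max, ENNReal.ofReal_zero, max_eq_left zero_le]
  simp only [e1, e2]
  rw [← ENNReal.ofReal_tsum_of_nonneg (fun i => le_max_right _ _) h1,
    ← ENNReal.ofReal_tsum_of_nonneg (fun i => le_max_right _ _) h2,
    ENNReal.toReal_ofReal (tsum_nonneg fun i => le_max_right _ _),
    ENNReal.toReal_ofReal (tsum_nonneg fun i => le_max_right _ _), ← h1.tsum_sub h2]
  refine tsum_congr fun i => ?_
  rcases le_total 0 (g i) with h | h <;> simp [h]

lemma summable_iff_tsum_ofReal_abs {ι : Type*} {g : ι → ℝ} :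
    Summable g ↔ ∑' i, ENNReal.ofReal |g i| ≠ ⊤ := by
  constructor
  · intro h
    exact h.abs.tsum_ofReal_ne_top
  · intro h
    have := ENNReal.summable_toReal h
    simp only [ENNReal.toReal_ofReal (abs_nonneg _)] at this
    exact this.of_abs

lemma measurable_energy {φ : EucSp d → EReal} (hφ : Measurable φ) :
    Measurable fun p : EucSp d × Config d => energy φ p.1 p.2.1 := by
  have hsub : Measurable fun q : (EucSp d × Config d) × EucSp d => φ (q.1.1 - q.2) :=
    hφ.comp (measurable_fst.fst.sub measurable_snd)
  have hM : ∀ F : EReal → ℝ≥0∞, Measurable F → Measurable fun p : EucSp d × Config d =>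
      ∑' y : p.2.1, F (φ (p.1 - y.1)) := fun F hF =>
    Config.measurable_tsum measurable_snd
      (h := fun (p : EucSp d × Config d) y => F (φ (p.1 - y))) (hF.comp hsub)
  have hr : Measurable EReal.toReal := measurable_ereal_toReal
  have m1 := hM (fun e => if e = ⊤ then 1 else 0)
    (Measurable.ite (measurableSet_singleton _) measurable_const measurable_const)
  have m2 := hM (fun e => ENNReal.ofReal |e.toReal|) (by fun_prop)
  have m3 := hM (fun e => ENNReal.ofReal e.toReal) (by fun_prop)
  have m4 := hM (fun e => ENNReal.ofReal (-e.toReal)) (by fun_prop)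
  have hset : MeasurableSet {p : EucSp d × Config d |
      (∀ y ∈ p.2.1, φ (p.1 - y) ≠ ⊤) ∧
        Summable (fun y : p.2.1 => (φ (p.1 - y.1)).toReal)} := by
    have h1 := m1 (measurableSet_singleton 0)
    have h2 := m2 (measurableSet_singleton ⊤).compl
    convert! h1.inter h2 using 1
    ext ⟨x, γ⟩
    simp only [summable_iff_tsum_ofReal_abs]
    simp [ENNReal.tsum_eq_zero]
  have : (fun p : EucSp d × Config d => energy φ p.1 p.2.1) = fun p =>
      if (∀ y ∈ p.2.1, φ (p.1 - y) ≠ ⊤) ∧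
        Summable (fun y : p.2.1 => (φ (p.1 - y.1)).toReal) then
      (((∑' y : p.2.1, ENNReal.ofReal (φ (p.1 - y.1)).toReal).toReal -
        (∑' y : p.2.1, ENNReal.ofReal (-(φ (p.1 - y.1)).toReal)).toReal : ℝ) : EReal) else ⊤ := by
    ext ⟨x, γ⟩
    simp only [energy]
    split_ifs with h
    · rw [h.2.tsum_eq_toReal_sub]
    · rfl
  rw [this]
  exact Measurable.ite hset (measurable_coe_real_ereal.comp
    (m3.ennreal_toReal.sub m4.ennreal_toReal)) measurable_const

lemma measurable_eexp : Measurable eexp := by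
  have hr : Measurable EReal.toReal := measurable_ereal_toReal
  unfold eexp
  exact Measurable.ite (measurableSet_singleton _) measurable_const
    (Measurable.ite (measurableSet_singleton _) measurable_const (by fun_prop))

lemma measurable_rexp : Measurable rexp := measurable_eexp.ennreal_toReal

lemma Config.finite_support {f : EucSp d → ℝ} (hf : HasCompactSupport f) (γ : Config d) :
    (Function.support fun x : γ.1 => f x.1).Finite := by
  refine Set.Finite.of_finite_image ((γ.2 _ hf).subset ?_) Subtype.val_injective.injOn
  rintro _ ⟨x, hx, rfl⟩
  exact ⟨x.2, subset_closure hx⟩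

lemma Config.summable {f : EucSp d → ℝ} (hf : HasCompactSupport f) (γ : Config d) :
    Summable fun x : γ.1 => f x.1 :=
  summable_of_hasFiniteSupport (γ.finite_support hf)

lemma measurable_cpair {f : EucSp d → ℝ} (hf : Measurable f) (hc : HasCompactSupport f) :
    Measurable (cpair f) := by
  have : cpair f = fun γ : Config d => (∑' i : γ.1, ENNReal.ofReal (f i.1)).toReal -
      (∑' i : γ.1, ENNReal.ofReal (-f i.1)).toReal := by
    ext γ
    rw [cpair, (γ.summable hc).tsum_eq_toReal_sub]
  rw [this]
  exact (Config.measurable_tsum measurable_id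
    (h := fun (_ : Config d) y => ENNReal.ofReal (f y)) (by
      unfold Function.uncurry; fun_prop)).ennreal_toReal.sub
    (Config.measurable_tsum measurable_id
    (h := fun (_ : Config d) y => ENNReal.ofReal (-f y)) (by
      unfold Function.uncurry; fun_prop)).ennreal_toReal

end Measurability

section ExponentialMoment

variable {d : ℕ}

lemma Config.measurable_tsum_tuples (n : ℕ) : ∀ {Ω : Type*} [MeasurableSpace Ω]
    {g : Ω → Config d} (_ : Measurable g) {h : Ω → (Fin n → EucSp d) → ℝ≥0∞}
    (_ : Measurable (Function.uncurry h)),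
    Measurable fun ω => ∑' p : Fin n → (g ω).1, h ω (fun i => (p i).1) := by
  induction n with
  | zero =>
    intro Ω _ g hg h hh
    have : (fun ω => ∑' p : Fin 0 → (g ω).1, h ω (fun i => (p i).1)) =
        fun ω => h ω Fin.elim0 := by
      ext ω
      rw [tsum_fintype, Fintype.sum_unique]
      congr 1
      exact Subsingleton.elim _ _
    rw [this]
    exact hh.comp (measurable_id.prodMk measurable_const)
  | succ n ih =>
    intro Ω _ g hg h hh
    have : (fun ω => ∑' p : Fin (n + 1) → (g ω).1, h ω (fun i => (p i).1)) =
        fun ω => ∑' x : (g ω).1, ∑' p : Fin n → (g ω).1,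
          h ω (Fin.cons x.1 fun i => (p i).1) := by
      ext ω
      rw [← (Fin.consEquiv fun _ => (g ω).1).tsum_eq, ENNReal.tsum_prod']
      refine tsum_congr fun x => tsum_congr fun p => ?_
      congr 1
      ext1 i
      refine Fin.cases ?_ (fun j => ?_) i <;> simp [Fin.consEquiv]
    rw [this]
    have hc : Measurable fun q : (Ω × EucSp d) × (Fin n → EucSp d) =>
        (q.1.1, (Fin.cons q.1.2 q.2 : Fin (n + 1) → EucSp d)) := by
      refine measurable_fst.fst.prodMk (measurable_pi_lambda _ fun i => ?_)
      refine Fin.cases ?_ (fun j => ?_) i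
      · simpa using measurable_fst.snd
      · simpa using (measurable_pi_apply j).fun_comp measurable_snd
    refine Config.measurable_tsum hg (h := fun ω x => ∑' p : Fin n → (g ω).1,
          h ω (Fin.cons x fun i => (p i).1)) ?_
    exact ih (Ω := Ω × EucSp d) (g := fun q => g q.1) (hg.comp measurable_fst)
      (h := fun q p => h q.1 (Fin.cons q.2 p)) (hh.comp hc)

lemma Config.measurable_tsum_injTuples (n : ℕ) {F : (Fin n → EucSp d) → ℝ≥0∞} (hF : Measurable F) :
    Measurable fun γ : Config d => ∑' p : injTuples n γ.1, F p.1 := by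
  have hinj : MeasurableSet {p : Fin n → EucSp d | Function.Injective p} := by
    have : {p : Fin n → EucSp d | Function.Injective p} =
        ⋂ i, ⋂ j, {p | p i = p j → i = j} := by
      ext p
      simp [Function.Injective]
    rw [this]
    refine MeasurableSet.iInter fun i => MeasurableSet.iInter fun j => ?_
    by_cases hij : i = j
    · simp [hij]
    · simp only [hij, imp_false]
      exact (measurableSet_eq_fun (measurable_pi_apply i) (measurable_pi_apply j)).compl
  have : (fun γ : Config d => ∑' p : injTuples n γ.1, F p.1) = fun γ =>
      ∑' p : Fin n → γ.1, {p : Fin n → EucSp d | Function.Injective p}.indicator F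
        (fun i => (p i).1) := by
    ext γ
    let e : injTuples n γ.1 → (Fin n → γ.1) := fun p i => ⟨p.1 i, p.2.2 i⟩
    have he : Function.Injective e := fun p q hpq => by
      ext1
      funext i
      exact congrArg Subtype.val (congrFun hpq i)
    rw [← he.tsum_eq]
    · refine tsum_congr fun p => ?_
      rw [Set.indicator_of_mem]
      exact p.2.1
    · intro p hp
      have hp' : (fun i => (p i).1) ∈ {p : Fin n → EucSp d | Function.Injective p} := by
        by_contra h
        exact hp (Set.indicator_of_notMem h _)
      exact ⟨⟨fun i => (p i).1, hp', fun i => (p i).2⟩, rfl⟩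
  rw [this]
  exact Config.measurable_tsum_tuples n measurable_id
    (h := fun (_ : Config d) p => {p : Fin n → EucSp d | Function.Injective p}.indicator F p)
    ((hF.indicator hinj).comp measurable_snd)

lemma factorial_mul_sum_powersetCard_le {α : Type*} (G : α → ℝ≥0∞) (t : Finset α) (n : ℕ) :
    (n.factorial : ℝ≥0∞) * ∑ T ∈ t.powersetCard n, ∏ x ∈ T, G x ≤
      ∑' p : Fin n ↪ α, ∏ i, G (p i) := by
  have hc : ∀ T : t.powersetCard n, T.1.card = n := fun T => (Finset.mem_powersetCard.1 T.2).2
  let e : (t.powersetCard n) × Equiv.Perm (Fin n) → (Fin n ↪ α) := fun q =>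
    q.2.toEmbedding.trans ((q.1.1.equivFinOfCardEq (hc q.1)).symm.toEmbedding.trans
      (Function.Embedding.subtype _))
  have hrange : ∀ q, Set.range (e q) = q.1.1 := fun q => by
    ext x
    constructor
    · rintro ⟨i, rfl⟩
      exact ((q.1.1.equivFinOfCardEq (hc q.1)).symm (q.2 i)).2
    · intro hx
      refine ⟨q.2.symm (q.1.1.equivFinOfCardEq (hc q.1) ⟨x, hx⟩), ?_⟩
      simp [e]
  have he : Function.Injective e := by
    rintro ⟨T, σ⟩ ⟨T', σ'⟩ h
    have h1 : T = T' := by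
      have := (hrange (T, σ)).symm.trans ((congrArg (fun f : Fin n ↪ α => Set.range f) h).trans
        (hrange (T', σ')))
      exact Subtype.ext (by exact_mod_cast this)
    subst h1
    congr 1
    ext1 i
    have h2 := DFunLike.congr_fun h i
    simpa [e] using h2
  have key : ∀ q, ∏ i, G (e q i) = ∏ x ∈ q.1.1, G x := fun q => by
    have h1 := Equiv.prod_comp (q.2.trans (q.1.1.equivFinOfCardEq (hc q.1)).symm)
      (fun x : q.1.1 => G x.1)
    rw [← Finset.prod_coe_sort q.1.1 G, ← h1]
    rfl
  calc (n.factorial : ℝ≥0∞) * ∑ T ∈ t.powersetCard n, ∏ x ∈ T, G x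
      = ∑ q : (t.powersetCard n) × Equiv.Perm (Fin n), ∏ i, G (e q i) := by
        simp only [key]
        rw [Fintype.sum_prod_type, ← Finset.sum_coe_sort, Finset.mul_sum]
        refine Finset.sum_congr rfl fun T _ => ?_
        simp [Fintype.card_perm]
    _ = ∑' q, ∏ i, G (e q i) := (tsum_fintype _).symm
    _ ≤ _ := ENNReal.tsum_comp_le_tsum_of_injective he fun p : Fin n ↪ α => ∏ i, G (p i)

lemma prod_one_add_le_tsum_injTuples (γ : Config d) (G : EucSp d → ℝ≥0∞) (t : Finset γ.1) :
    ∏ x ∈ t, (1 + G x.1) ≤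
      ∑' n : ℕ, (n.factorial : ℝ≥0∞)⁻¹ * ∑' p : injTuples n γ.1, ∏ i, G (p.1 i) := by
  rw [Finset.prod_one_add, Finset.sum_powerset]
  refine le_trans (Finset.sum_le_sum fun n _ => ?_) (ENNReal.sum_le_tsum (Finset.range (t.card + 1)))
  rw [mul_comm, ← div_eq_mul_inv, ENNReal.le_div_iff_mul_le
    (Or.inl (by exact_mod_cast n.factorial_ne_zero)) (Or.inl (by simp)), mul_comm]
  refine (factorial_mul_sum_powersetCard_le (fun x : γ.1 => G x.1) t n).trans ?_
  let e : (Fin n ↪ γ.1) → injTuples n γ.1 := fun p =>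
    ⟨fun i => (p i).1, fun i j h => p.injective (Subtype.ext h), fun i => (p i).2⟩
  have he : Function.Injective e := fun p q h => by
    refine DFunLike.ext _ _ fun i => Subtype.ext ?_
    exact congrFun (congrArg Subtype.val h) i
  exact ENNReal.tsum_comp_le_tsum_of_injective he fun p : injTuples n γ.1 => ∏ i, G (p.1 i)

lemma lintegral_fin_prod_eq_pow {G : EucSp d → ℝ≥0∞} (hG : Measurable G) (n : ℕ) :
    ∫⁻ x : Fin n → EucSp d, ∏ i, G (x i) = (∫⁻ x, G x) ^ n := by
  induction n with
  | zero => simp [volume_pi]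
  | succ n ih =>
    have h := (volume_preserving_piFinSuccAbove (fun _ : Fin (n + 1) => EucSp d) 0).symm
    rw [← h.lintegral_comp_emb (MeasurableEquiv.measurableEmbedding _), pow_succ', ← ih]
    have hm : Measurable fun x : Fin n → EucSp d => ∏ i, G (x i) :=
      Finset.measurable_fun_prod _ fun i _ => hG.comp (measurable_pi_apply i)
    rw [← lintegral_prod_mul hG.aemeasurable hm.aemeasurable]
    refine lintegral_congr fun p => ?_
    rw [Fin.prod_univ_succ]
    simp [MeasurableEquiv.piFinSuccAbove]

lemma lintegral_tsum_injTuples_le {μ : Measure (Config d)} [IsProbabilityMeasure μ]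
    {k : ∀ n : ℕ, (Fin n → EucSp d) → ℝ} {ξ : ℝ} (hk : HasCorrFns μ k) (hb : RuelleBound k ξ)
    {G : EucSp d → ℝ≥0∞} (hG : Measurable G) (n : ℕ) :
    ∫⁻ γ, ∑' p : injTuples n γ.1, ∏ i, G (p.1 i) ∂μ ≤ (ENNReal.ofReal ξ * ∫⁻ x, G x) ^ n := by
  rcases Nat.eq_zero_or_pos n with rfl | hn
  · have : ∀ γ : Config d, ∑' p : injTuples 0 γ.1, ∏ i, G (p.1 i) = 1 := fun γ => by
      have : Unique (injTuples 0 γ.1) :=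
        { default := ⟨Fin.elim0, fun i => i.elim0, fun i => i.elim0⟩
          uniq := fun p => Subtype.ext (Subsingleton.elim _ _) }
      simp
    simp only [this]
    simp
  · rw [hk.2 n hn (fun p => ∏ i, G (p i)) (by fun_prop)
      (fun σ x => Equiv.prod_comp σ fun i => G (x i)), mul_pow, ← lintegral_fin_prod_eq_pow hG,
      ← lintegral_const_mul _ (by fun_prop)]
    refine lintegral_mono fun x => ?_
    rw [mul_comm]
    gcongr
    have hξ : 0 ≤ ξ := by
      have h1 := (hk.1 1).2.1 0
      have h2 := hb 1 one_pos 0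
      linarith
    rw [← ENNReal.ofReal_pow hξ]
    exact ENNReal.ofReal_le_ofReal (hb n hn x)

lemma eexp_coe (r : ℝ) : eexp (r : EReal) = ENNReal.ofReal (Real.exp r) := by
  simp [eexp]

lemma eexp_top : eexp ⊤ = ⊤ := by simp [eexp]

lemma eexp_bot : eexp ⊥ = 0 := by simp [eexp]

lemma eexp_mono : Monotone eexp := by
  intro x y hxy
  induction x with
  | bot => simp [eexp_bot]
  | top => simp [top_le_iff.1 hxy]
  | coe x =>
    induction y with
    | bot => simp at hxy
    | top => simp [eexp_top]
    | coe y =>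
      rw [eexp_coe, eexp_coe]
      exact ENNReal.ofReal_le_ofReal (Real.exp_le_exp.2 (by exact_mod_cast hxy))

lemma eexp_tsum_le {ι : Type*} {g : ι → ℝ} (hg : ∀ i, 0 ≤ g i) {R : ℝ≥0∞}
    (h : ∀ t : Finset ι, ENNReal.ofReal (Real.exp (∑ i ∈ t, g i)) ≤ R) :
    eexp ((∑' i, ENNReal.ofReal (g i) : ℝ≥0∞) : EReal) ≤ R := by
  rcases eq_or_ne R ⊤ with rfl | hR
  · exact le_top
  have hR1 : 1 ≤ R.toReal := by
    have := h ∅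
    simp only [Finset.sum_empty, Real.exp_zero, ENNReal.ofReal_one] at this
    simpa using ENNReal.toReal_mono hR this
  have h1 : ∑' i, ENNReal.ofReal (g i) ≤ ENNReal.ofReal (Real.log R.toReal) := by
    rw [ENNReal.tsum_eq_iSup_sum]
    refine iSup_le fun t => ?_
    rw [← ENNReal.ofReal_sum_of_nonneg fun i _ => hg i]
    refine ENNReal.ofReal_le_ofReal ?_
    rw [Real.le_log_iff_exp_le (by linarith)]
    exact (ENNReal.ofReal_le_iff_le_toReal hR).1 (h t)
  refine (eexp_mono (EReal.coe_ennreal_le_coe_ennreal_iff.2 h1)).trans ?_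
  rw [EReal.coe_ennreal_ofReal, max_eq_left (Real.log_nonneg hR1), eexp_coe,
    Real.exp_log (by linarith), ENNReal.ofReal_toReal hR]

lemma eexp_tsum_le_tsum_injTuples (γ : Config d) {q : EucSp d → ℝ} (hq : ∀ x, 0 ≤ q x) :
    eexp ((∑' x : γ.1, ENNReal.ofReal (q x.1) : ℝ≥0∞) : EReal) ≤
      ∑' n : ℕ, (n.factorial : ℝ≥0∞)⁻¹ *
        ∑' p : injTuples n γ.1, ∏ i, ENNReal.ofReal (Real.exp (q (p.1 i)) - 1) := by
  refine eexp_tsum_le (fun i : γ.1 => hq i.1) fun t => ?_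
  refine le_trans (le_of_eq ?_)
    (prod_one_add_le_tsum_injTuples γ (fun x => ENNReal.ofReal (Real.exp (q x) - 1)) t)
  rw [Real.exp_sum, ENNReal.ofReal_prod_of_nonneg fun i _ => (Real.exp_pos _).le]
  refine Finset.prod_congr rfl fun x _ => ?_
  rw [← ENNReal.ofReal_one, ← ENNReal.ofReal_add zero_le_one
    (sub_nonneg.2 (Real.one_le_exp (hq _)))]
  congr 1
  ring

lemma tsum_inv_factorial_mul_pow (c : ℝ≥0∞) (hc : c ≠ ⊤) :
    ∑' n : ℕ, (n.factorial : ℝ≥0∞)⁻¹ * c ^ n = ENNReal.ofReal (Real.exp c.toReal) := by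
  have h := NormedSpace.expSeries_div_hasSum_exp (𝔸 := ℝ) c.toReal
  rw [← Real.exp_eq_exp_ℝ] at h
  rw [← h.tsum_eq, ENNReal.ofReal_tsum_of_nonneg (fun n => by positivity) h.summable]
  refine tsum_congr fun n => ?_
  rw [ENNReal.ofReal_div_of_pos (by positivity), ENNReal.ofReal_pow ENNReal.toReal_nonneg,
    ENNReal.ofReal_toReal hc, ENNReal.ofReal_natCast, div_eq_mul_inv, mul_comm]

/-- Exponential moments of nonnegative additive functionals under the Ruelle bound. -/
lemma lintegral_eexp_tsum_le {μ : Measure (Config d)} [IsProbabilityMeasure μ]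
    {k : ∀ n : ℕ, (Fin n → EucSp d) → ℝ} {ξ : ℝ} (hk : HasCorrFns μ k) (hb : RuelleBound k ξ)
    {q : EucSp d → ℝ} (hqm : Measurable q) (hq : ∀ x, 0 ≤ q x) {M : ℝ} (hM : ∀ x, q x ≤ M)
    {K : ℝ≥0∞} (hK : K ≠ ⊤) (hqK : ∫⁻ x, ENNReal.ofReal (q x) ≤ K) :
    ∫⁻ γ, eexp ((∑' x : γ.1, ENNReal.ofReal (q x.1) : ℝ≥0∞) : EReal) ∂μ ≤
      ENNReal.ofReal (Real.exp (ENNReal.ofReal ξ * (ENNReal.ofReal (Real.exp M) * K)).toReal) := by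
  have hG : Measurable fun x => ENNReal.ofReal (Real.exp (q x) - 1) := by fun_prop
  have hGK : ∫⁻ x, ENNReal.ofReal (Real.exp (q x) - 1) ≤ ENNReal.ofReal (Real.exp M) * K := by
    calc ∫⁻ x, ENNReal.ofReal (Real.exp (q x) - 1)
        ≤ ∫⁻ x, ENNReal.ofReal (Real.exp M) * ENNReal.ofReal (q x) := by
          refine lintegral_mono fun x => ?_
          rw [← ENNReal.ofReal_mul (Real.exp_pos M).le]
          refine ENNReal.ofReal_le_ofReal ?_
          have h1 : 1 - q x ≤ Real.exp (-q x) := by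
            have := Real.add_one_le_exp (-q x)
            linarith
          have h2 : Real.exp (q x) * Real.exp (-q x) = 1 := by
            rw [← Real.exp_add]; simp
          have h3 := Real.exp_le_exp.2 (hM x)
          have h4 := mul_le_mul_of_nonneg_left h1 (Real.exp_pos (q x)).le
          have h5 := mul_le_mul_of_nonneg_right h3 (hq x)
          linarith
      _ = ENNReal.ofReal (Real.exp M) * ∫⁻ x, ENNReal.ofReal (q x) :=
          lintegral_const_mul _ (by fun_prop)
      _ ≤ _ := by gcongr
  calc ∫⁻ γ, eexp ((∑' x : γ.1, ENNReal.ofReal (q x.1) : ℝ≥0∞) : EReal) ∂μ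
      ≤ ∫⁻ γ, ∑' n : ℕ, (n.factorial : ℝ≥0∞)⁻¹ *
        ∑' p : injTuples n γ.1, ∏ i, ENNReal.ofReal (Real.exp (q (p.1 i)) - 1) ∂μ :=
        lintegral_mono fun γ => eexp_tsum_le_tsum_injTuples γ hq
    _ = ∑' n : ℕ, (n.factorial : ℝ≥0∞)⁻¹ * ∫⁻ γ,
        ∑' p : injTuples n γ.1, ∏ i, ENNReal.ofReal (Real.exp (q (p.1 i)) - 1) ∂μ := by
        have hm : ∀ n, Measurable fun γ : Config d => ∑' p : injTuples n γ.1,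
            ∏ i, ENNReal.ofReal (Real.exp (q (p.1 i)) - 1) := fun n =>
          Config.measurable_tsum_injTuples n
            (F := fun p => ∏ i, ENNReal.ofReal (Real.exp (q (p i)) - 1)) (by fun_prop)
        rw [lintegral_tsum fun n => ((hm n).const_mul _).aemeasurable]
        exact tsum_congr fun n => lintegral_const_mul _ (hm n)
    _ ≤ ∑' n : ℕ, (n.factorial : ℝ≥0∞)⁻¹ *
        (ENNReal.ofReal ξ * (ENNReal.ofReal (Real.exp M) * K)) ^ n := by
        refine ENNReal.tsum_le_tsum fun n => ?_
        gcongr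
        refine (lintegral_tsum_injTuples_le hk hb hG n).trans ?_
        gcongr
    _ = _ := tsum_inv_factorial_mul_pow _
        (ENNReal.mul_ne_top ENNReal.ofReal_ne_top (ENNReal.mul_ne_top ENNReal.ofReal_ne_top hK))

end ExponentialMoment

section Energy

variable {d : ℕ} {φ : EucSp d → EReal}

lemma energy_ne_bot (x : EucSp d) (γ : Set (EucSp d)) : energy φ x γ ≠ ⊥ := by
  unfold energy
  split_ifs
  · exact EReal.coe_ne_bot _
  · exact top_ne_bot

lemma energy_insert (hφ : ∀ v, φ v ≠ ⊥) {x x' : EucSp d} {γ : Set (EucSp d)} (hx' : x' ∉ γ)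
    (hE : energy φ x γ ≠ ⊤) (hv : φ (x - x') ≠ ⊤) :
    energy φ x (insert x' γ) = energy φ x γ + φ (x - x') := by
  have h : (∀ y ∈ γ, φ (x - y) ≠ ⊤) ∧ Summable (fun y : γ => (φ (x - y.1)).toReal) := by
    by_contra h
    exact hE (by rw [energy, if_neg h])
  have h1 : HasSum (fun y : γ => (φ (x - y.1)).toReal) _ := h.2.hasSum
  have h0 : HasSum (fun y : ({x'} : Set (EucSp d)) => (φ (x - y.1)).toReal)
      (φ (x - x')).toReal := by
    simpa using hasSum_fintype (fun y : ({x'} : Set (EucSp d)) => (φ (x - y.1)).toReal)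
  have h2 : HasSum (fun y : ((insert x' γ : Set (EucSp d))) => (φ (x - y.1)).toReal)
      ((φ (x - x')).toReal + ∑' y : γ, (φ (x - y.1)).toReal) := by
    rw [Set.insert_eq]
    exact HasSum.add_disjoint (f := fun y => (φ (x - y)).toReal)
      (Set.disjoint_singleton_left.2 hx') h0 h1
  have h3 : ∀ y ∈ insert x' γ, φ (x - y) ≠ ⊤ := by
    rintro y (rfl | hy)
    exacts [hv, h.1 y hy]
  rw [energy, energy, if_pos ⟨h3, h2.summable⟩, if_pos h, h2.tsum_eq, add_comm, EReal.coe_add,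
    EReal.coe_toReal hv (hφ _)]

/-- The negative part of a pair potential. -/
def phiNeg (φ : EucSp d → EReal) (v : EucSp d) : ℝ := max (-(φ v).toReal) 0

lemma phiNeg_nonneg (v : EucSp d) : 0 ≤ phiNeg φ v := le_max_right _ _

lemma measurable_phiNeg (hφ : Measurable φ) : Measurable (phiNeg φ) :=
  (hφ.ereal_toReal.neg).max measurable_const

lemma mul_phi_le (hφ : ∀ v, φ v ≠ ⊥) {t : ℝ} (ht : t ≤ 0) (ht1 : -1 ≤ t) (v : EucSp d) :
    (t : EReal) * φ v ≤ (phiNeg φ v : EReal) := by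
  rcases eq_or_ne (φ v) ⊤ with h | h
  · rcases ht.eq_or_lt with rfl | ht
    · simpa using phiNeg_nonneg v
    · rw [h, EReal.coe_mul_top_of_neg ht]
      exact bot_le
  · rw [← EReal.coe_toReal h (hφ v), ← EReal.coe_mul, EReal.coe_le_coe_iff]
    have h1 := le_max_left (-(φ v).toReal) 0
    have h2 := le_max_right (-(φ v).toReal) 0
    unfold phiNeg
    nlinarith

lemma mul_energy_le {t : ℝ} (ht : t ≤ 0) (ht1 : -1 ≤ t) (x : EucSp d)
    (γ : Set (EucSp d)) : (t : EReal) * energy φ x γ ≤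
      ((∑' y : γ, ENNReal.ofReal (phiNeg φ (x - y.1)) : ℝ≥0∞) : EReal) := by
  by_cases h : (∀ y ∈ γ, φ (x - y) ≠ ⊤) ∧ Summable (fun y : γ => (φ (x - y.1)).toReal)
  · rw [energy, if_pos h]
    have h2 : Summable fun y : γ => phiNeg φ (x - y.1) :=
      Summable.of_nonneg_of_le (fun y => phiNeg_nonneg _)
        (fun y => max_le (neg_le_abs _) (abs_nonneg _)) h.2.abs
    have h0 : 0 ≤ ∑' y : γ, phiNeg φ (x - y.1) := tsum_nonneg fun _ => phiNeg_nonneg _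
    rw [← ENNReal.ofReal_tsum_of_nonneg (fun _ => phiNeg_nonneg _) h2, EReal.coe_ennreal_ofReal,
      max_eq_left h0, ← EReal.coe_mul, EReal.coe_le_coe_iff]
    have h3 : -∑' y : γ, (φ (x - y.1)).toReal ≤ ∑' y : γ, phiNeg φ (x - y.1) := by
      rw [← tsum_neg]
      exact h.2.neg.tsum_le_tsum (fun y => le_max_left _ _) h2
    nlinarith
  · rw [energy, if_neg h]
    rcases ht.eq_or_lt with rfl | ht
    · simpa using EReal.coe_ennreal_nonneg _
    · rw [EReal.coe_mul_top_of_neg ht]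
      exact bot_le

lemma rexp_coe (r : ℝ) : rexp (r : EReal) = Real.exp r := by
  rw [rexp, eexp_coe, ENNReal.toReal_ofReal (Real.exp_pos r).le]

lemma rexp_nonneg (x : EReal) : 0 ≤ rexp x := ENNReal.toReal_nonneg

lemma ofReal_rexp_le {x y : EReal} (h : x ≤ y) : ENNReal.ofReal (rexp x) ≤ eexp y :=
  ENNReal.ofReal_toReal_le.trans (eexp_mono h)

lemma rexp_le {x : EReal} {r : ℝ} (h : x ≤ r) : rexp x ≤ Real.exp r := by
  rw [← rexp_coe]
  exact ENNReal.toReal_mono (by simp [eexp_coe]) (eexp_mono h)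

lemma Config.mul_cpair_le (f : EucSp d → ℝ) (hf : HasCompactSupport f) (γ : Config d) :
    ((2 * cpair f γ : ℝ) : EReal) ≤
      ((∑' y : γ.1, ENNReal.ofReal (2 * |f y.1|) : ℝ≥0∞) : EReal) := by
  have h := γ.summable hf
  have h2 : Summable fun y : γ.1 => 2 * |f y.1| := h.abs.mul_left 2
  rw [← ENNReal.ofReal_tsum_of_nonneg (fun _ => by positivity) h2, EReal.coe_ennreal_ofReal,
    EReal.coe_le_coe_iff]
  refine le_max_of_le_left ?_
  rw [cpair, ← tsum_mul_left]
  exact (h.mul_left 2).tsum_le_tsum (fun y => by have := le_abs_self (f y.1); linarith) h2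

end Energy

section GibbsEstimates

variable {d : ℕ} {s z B ξ : ℝ} {φ : EucSp d → EReal} {μ : Measure (Config d)}
  {k u : ∀ n : ℕ, (Fin n → EucSp d) → ℝ}

lemma Setting.phiNeg_bdd (h : Setting d s z B ξ φ μ k u) : ∃ M : ℝ, ∀ v, phiNeg φ v ≤ M := by
  refine ⟨max (2 * B) (phiNeg φ 0), fun v => ?_⟩
  rcases eq_or_ne v 0 with rfl | hv
  · exact le_max_right _ _
  · refine le_max_of_le_left (max_le ?_ (by linarith [h.hB]))
    have h1 := h.stable {v, 0}
    rw [Finset.offDiag_insert (by simpa using hv)] at h1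
    obtain ⟨r, hr⟩ : ∃ r : ℝ, φ v = r :=
      ⟨_, (EReal.coe_toReal (h.pp.finite_off v hv) (h.pp.ne_bot v)).symm⟩
    have h2 : ((v, (0 : EucSp d))) ≠ (0, v) := fun h' => hv (congrArg Prod.fst h')
    have h3 : (0 : EucSp d) ∉ ({v} : Finset (EucSp d)) := by simpa using hv.symm
    simp [h2, h.pp.even v hv, hr, Finset.card_insert_of_notMem, hv] at h1
    have h4 : -(2 * B * 2) ≤ r + r := by exact_mod_cast h1
    rw [hr, EReal.toReal_coe]
    linarith

lemma Setting.lintegral_rexp_lt_top (h : Setting d s z B ξ φ μ k u) :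
    ∫⁻ x, ENNReal.ofReal |rexp (-(φ x)) - 1| < ⊤ := by
  have h1 := h.laht.trans ENNReal.ofReal_lt_top
  have hm : Measurable fun x => ENNReal.ofReal |rexp (-(φ x)) - 1| := by
    have := measurable_rexp.comp (h.pp.meas.neg)
    exact ((this.sub_const 1).abs).ennreal_ofReal
  simp only [ENNReal.ofReal_mul (abs_nonneg _)] at h1
  rw [lintegral_mul_const _ hm] at h1
  exact ENNReal.lt_top_of_mul_ne_top_left h1.ne (by simpa using h.hz)

lemma Setting.lintegral_phiNeg_lt_top (h : Setting d s z B ξ φ μ k u) :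
    ∫⁻ x, ENNReal.ofReal (phiNeg φ x) < ⊤ := by
  have : NeZero d := ⟨h.hd.ne'⟩
  refine lt_of_le_of_lt (lintegral_mono_ae ?_) h.lintegral_rexp_lt_top
  filter_upwards [compl_mem_ae_iff.2 (measure_singleton (0 : EucSp d))] with v hv
  refine ENNReal.ofReal_le_ofReal (max_le ?_ (abs_nonneg _))
  obtain ⟨r, hr⟩ : ∃ r : ℝ, φ v = r :=
    ⟨_, (EReal.coe_toReal (h.pp.finite_off v hv) (h.pp.ne_bot v)).symm⟩
  rw [hr, ← EReal.coe_neg, rexp_coe, EReal.toReal_coe]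
  have := Real.add_one_le_exp (-r)
  exact le_trans (by linarith) (le_abs_self _)

/-- The exponent dominating all the weights that occur. -/
def domExp (φ : EucSp d → EReal) (f : EucSp d → ℝ) (x : Fin 4 → EucSp d) (γ : Config d) : ℝ≥0∞ :=
  ∑' y : γ.1, ENNReal.ofReal (∑ i, phiNeg φ (x i - y.1) + 2 * |f y.1|)

lemma domExp_eq (f : EucSp d → ℝ) (x : Fin 4 → EucSp d) (γ : Config d) :
    domExp φ f x γ = ∑ i, ∑' y : γ.1, ENNReal.ofReal (phiNeg φ (x i - y.1)) +
      ∑' y : γ.1, ENNReal.ofReal (2 * |f y.1|) := by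
  simp only [domExp, Fin.sum_univ_four]
  rw [← ENNReal.tsum_add, ← ENNReal.tsum_add, ← ENNReal.tsum_add, ← ENNReal.tsum_add]
  refine tsum_congr fun y => ?_
  have := fun i => phiNeg_nonneg (φ := φ) (x i - y.1)
  have h0 := this 0
  have h1 := this 1
  have h2 := this 2
  have h3 := this 3
  rw [ENNReal.ofReal_add (by positivity) (by positivity), ENNReal.ofReal_add (by positivity) h3,
    ENNReal.ofReal_add (by positivity) h2, ENNReal.ofReal_add h0 h1]

lemma Setting.exists_lintegral_domExp_le (h : Setting d s z B ξ φ μ k u) {f : EucSp d → ℝ}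
    (hf : IsC0 f) : ∃ C : ℝ≥0∞, C ≠ ⊤ ∧ ∀ x : Fin 4 → EucSp d,
      ∫⁻ γ, eexp ((domExp φ f x γ : ℝ≥0∞) : EReal) ∂μ ≤ C := by
  have := h.prob
  obtain ⟨M, hM⟩ := h.phiNeg_bdd
  obtain ⟨M', hM'⟩ := hf.2.exists_bound_of_continuous hf.1
  have hint : Integrable f := hf.1.integrable_of_hasCompactSupport hf.2
  have hfm : Measurable f := hf.1.measurable
  have hpm := measurable_phiNeg h.pp.meas
  set I := ∫⁻ x, ENNReal.ofReal (phiNeg φ x) with hI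
  have hK : 4 * I + ENNReal.ofReal 2 * ∫⁻ x, ‖f x‖ₑ ≠ ⊤ := by
    refine ENNReal.add_ne_top.2 ⟨?_, ?_⟩
    · exact ENNReal.mul_ne_top (by simp) h.lintegral_phiNeg_lt_top.ne
    · exact ENNReal.mul_ne_top (by simp) hint.2.ne
  refine ⟨_, ?_, fun x => lintegral_eexp_tsum_le h.corr h.ruelle
    (q := fun y => ∑ i, phiNeg φ (x i - y) + 2 * |f y|) ?_ ?_ (M := 4 * M + 2 * M') ?_ hK ?_⟩
  · exact ENNReal.ofReal_ne_top
  · have : ∀ i, Measurable fun y => phiNeg φ (x i - y) := fun i =>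
      hpm.comp (measurable_const.sub measurable_id)
    fun_prop
  · intro y
    have := fun i => phiNeg_nonneg (φ := φ) (x i - y)
    have : 0 ≤ ∑ i, phiNeg φ (x i - y) := Finset.sum_nonneg fun i _ => this i
    positivity
  · intro y
    simp only [Fin.sum_univ_four]
    have h0 := hM (x 0 - y)
    have h1 := hM (x 1 - y)
    have h2 := hM (x 2 - y)
    have h3 := hM (x 3 - y)
    have h4 := hM' y
    rw [Real.norm_eq_abs] at h4
    linarith
  · have hsum : ∀ y, ENNReal.ofReal (∑ i, phiNeg φ (x i - y) + 2 * |f y|) =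
        ∑ i, ENNReal.ofReal (phiNeg φ (x i - y)) + ENNReal.ofReal 2 * ‖f y‖ₑ := fun y => by
      rw [ENNReal.ofReal_add (Finset.sum_nonneg fun i _ => phiNeg_nonneg _) (by positivity),
        ENNReal.ofReal_sum_of_nonneg fun i _ => phiNeg_nonneg _,
        ENNReal.ofReal_mul zero_le_two, ← Real.norm_eq_abs, ofReal_norm]
    simp only [hsum]
    have hmi : ∀ i, Measurable fun y => ENNReal.ofReal (phiNeg φ (x i - y)) := fun i =>
      (hpm.comp (measurable_const.sub measurable_id)).ennreal_ofReal
    rw [lintegral_add_left (Finset.measurable_fun_sum _ fun i _ => hmi i),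
      lintegral_finsetSum _ fun i _ => hmi i, lintegral_const_mul _ (by fun_prop)]
    have : ∀ i, ∫⁻ y, ENNReal.ofReal (phiNeg φ (x i - y)) = I := fun i =>
      lintegral_sub_left_eq_self (fun v => ENNReal.ofReal (phiNeg φ v)) (x i)
    simp [this]

lemma Setting.ae_tsum_ne_top (h : Setting d s z B ξ φ μ k u) {q : EucSp d → ℝ}
    (hqm : Measurable q) (hq : ∀ x, 0 ≤ q x) {M : ℝ} (hM : ∀ x, q x ≤ M)
    (hqK : ∫⁻ x, ENNReal.ofReal (q x) ≠ ⊤) :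
    ∀ᵐ γ ∂μ, ∑' x : γ.1, ENNReal.ofReal (q x.1) ≠ ⊤ := by
  have := h.prob
  have h1 := lintegral_eexp_tsum_le h.corr h.ruelle hqm hq hM hqK le_rfl
  have hm : Measurable fun γ : Config d => ∑' x : γ.1, ENNReal.ofReal (q x.1) :=
    Config.measurable_tsum measurable_id (h := fun (_ : Config d) x => ENNReal.ofReal (q x))
      (hqm.ennreal_ofReal.comp measurable_snd)
  have h2 := ae_lt_top (measurable_eexp.comp (measurable_coe_ennreal_ereal.comp hm))
    (h1.trans_lt ENNReal.ofReal_lt_top).ne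
  filter_upwards [h2] with γ hγ hγ'
  simp [hγ', eexp_top] at hγ

lemma Setting.ae_notMem (h : Setting d s z B ξ φ μ k u) (x : EucSp d) :
    ∀ᵐ γ ∂μ, x ∉ γ.1 := by
  have := h.prob
  have : NeZero d := ⟨h.hd.ne'⟩
  have hset : MeasurableSet {γ : Config d | x ∈ γ.1} :=
    Config.measurableSet_mem.preimage (measurable_id.prodMk measurable_const)
  rw [ae_iff]
  simp only [not_not]
  by_contra hne
  have key : ∀ n : ℕ, (n : ℝ≥0∞) * μ {γ : Config d | x ∈ γ.1} ≤ 1 := fun n => by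
    have h1 := lintegral_eexp_tsum_le h.corr h.ruelle
      (q := ({x} : Set (EucSp d)).indicator fun _ => (n : ℝ))
      (measurable_const.indicator (measurableSet_singleton x))
      (fun y => Set.indicator_nonneg (fun _ _ => n.cast_nonneg) y) (M := n)
      (fun y => Set.indicator_le_self' (fun _ _ => n.cast_nonneg) y)
      (K := 0) ENNReal.zero_ne_top (by
        have : (fun y => ENNReal.ofReal (({x} : Set (EucSp d)).indicator (fun _ => (n : ℝ)) y)) =
            ({x} : Set (EucSp d)).indicator fun _ => (n : ℝ≥0∞) := by
          ext y
          by_cases hy : y ∈ ({x} : Set (EucSp d)) <;> simp [hy]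
        rw [this, lintegral_indicator_const (measurableSet_singleton x)]
        simp)
    simp only [mul_zero, ENNReal.toReal_zero, Real.exp_zero, ENNReal.ofReal_one] at h1
    refine le_trans ?_ h1
    rw [← lintegral_indicator_const hset]
    refine lintegral_mono fun γ => ?_
    by_cases hγ : γ ∈ {γ : Config d | x ∈ γ.1}
    · rw [Set.indicator_of_mem hγ]
      have h2 : (n : ℝ≥0∞) ≤ ∑' y : γ.1, ENNReal.ofReal
          (({x} : Set (EucSp d)).indicator (fun _ => (n : ℝ)) y.1) := by
        refine le_trans ?_ (ENNReal.le_tsum ⟨x, hγ⟩)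
        simp
      refine le_trans ?_ (eexp_mono (EReal.coe_ennreal_le_coe_ennreal_iff.2 h2))
      have h3 : ((n : ℝ≥0∞) : EReal) = ((n : ℝ) : EReal) := by
        rw [← ENNReal.ofReal_natCast, EReal.coe_ennreal_ofReal, max_eq_left n.cast_nonneg]
      rw [h3, eexp_coe, ← ENNReal.ofReal_natCast]
      exact ENNReal.ofReal_le_ofReal (by linarith [Real.add_one_le_exp (n : ℝ)])
    · rw [Set.indicator_of_notMem hγ]
      exact zero_le
  obtain ⟨n, hn⟩ := ENNReal.exists_nat_mul_gt hne ENNReal.one_ne_top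
  exact absurd (key n) (not_le.2 hn)

lemma abs_le_exp_mul_abs_exp_sub_one {r C : ℝ} (hr : |r| ≤ C) :
    |r| ≤ Real.exp C * |Real.exp (-r) - 1| := by
  have hC : 0 ≤ C := (abs_nonneg r).trans hr
  have h1 : 1 ≤ Real.exp C := Real.one_le_exp hC
  rcases le_total 0 r with h | h
  · rw [abs_of_nonneg h] at hr ⊢
    have h2 : Real.exp (-r) ≤ 1 := Real.exp_le_one_iff.2 (by linarith)
    rw [abs_of_nonpos (by linarith)]
    have h3 := Real.add_one_le_exp r
    have h4 : Real.exp r * Real.exp (-r) = 1 := by rw [← Real.exp_add]; simp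
    have h5 : Real.exp r ≤ Real.exp C := Real.exp_le_exp.2 hr
    nlinarith
  · have h2 := Real.add_one_le_exp (-r)
    rw [abs_of_nonpos h, abs_of_nonneg (by linarith)]
    nlinarith

lemma Setting.ae_energy_ne_top (h : Setting d s z B ξ φ μ k u) (x : EucSp d) :
    ∀ᵐ γ ∂μ, energy φ x γ.1 ≠ ⊤ := by
  obtain ⟨R, C, hRC⟩ := h.bddOutside
  let D : Set (EucSp d) := {v | R ≤ ‖v‖}
  have hD : MeasurableSet D := measurableSet_le measurable_const measurable_norm
  have hDx : Measurable fun y : EucSp d => x - y := measurable_const.sub measurable_id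
  let q₀ : EucSp d → ℝ := D.indicator fun v => |(φ v).toReal|
  have hq₀ : Measurable q₀ := (h.pp.meas.ereal_toReal.abs).indicator hD
  have hq₀0 : ∀ v, 0 ≤ q₀ v := fun v => Set.indicator_nonneg (fun _ _ => abs_nonneg _) v
  have hq₀C : ∀ v, q₀ v ≤ max C 0 := fun v => by
    by_cases hv : v ∈ D
    · obtain ⟨r, hr, hr'⟩ := hRC v hv
      simp only [q₀, Set.indicator_of_mem hv, hr, EReal.toReal_coe]
      exact le_max_of_le_left hr'
    · simp only [q₀, Set.indicator_of_notMem hv]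
      exact le_max_right _ _
  have hq₀i : ∫⁻ v, ENNReal.ofReal (q₀ v) ≠ ⊤ := by
    have hle : ∫⁻ v, ENNReal.ofReal (q₀ v) ≤
        ∫⁻ v, ENNReal.ofReal (Real.exp C) * ENNReal.ofReal |rexp (-(φ v)) - 1| := by
      refine lintegral_mono fun v => ?_
      rw [← ENNReal.ofReal_mul (Real.exp_pos _).le]
      refine ENNReal.ofReal_le_ofReal ?_
      by_cases hv : v ∈ D
      · obtain ⟨r, hr, hr'⟩ := hRC v hv
        simp only [q₀, Set.indicator_of_mem hv, hr, EReal.toReal_coe]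
        rw [← EReal.coe_neg, rexp_coe]
        exact abs_le_exp_mul_abs_exp_sub_one hr'
      · simp only [q₀, Set.indicator_of_notMem hv]
        positivity
    rw [lintegral_const_mul' _ _ ENNReal.ofReal_ne_top] at hle
    exact (hle.trans_lt (ENNReal.mul_lt_top ENNReal.ofReal_lt_top h.lintegral_rexp_lt_top)).ne
  have h1 := h.ae_tsum_ne_top (q := fun y => q₀ (x - y)) (hq₀.comp hDx) (fun y => hq₀0 _)
    (fun y => hq₀C _) (by
      rw [lintegral_sub_left_eq_self (fun v => ENNReal.ofReal (q₀ v)) x]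
      exact hq₀i)
  filter_upwards [h1, h.ae_notMem x] with γ hγ hx
  have hs : Summable (fun y : γ.1 => (φ (x - y.1)).toReal) := by
    have hs1 : Summable fun y : γ.1 => q₀ (x - y.1) := by
      rw [summable_iff_tsum_ofReal_abs]
      simpa only [abs_of_nonneg (hq₀0 _)] using hγ
    have hs2 : Summable fun y : γ.1 => Dᶜ.indicator (fun v => |(φ v).toReal|) (x - y.1) := by
      refine summable_of_hasFiniteSupport ?_
      refine Set.Finite.of_finite_image ((γ.2 _ (isCompact_closedBall x R)).subset ?_)
        Subtype.val_injective.injOn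
      rintro _ ⟨y, hy, rfl⟩
      refine ⟨y.2, ?_⟩
      have : x - y.1 ∈ Dᶜ := Set.mem_of_indicator_ne_zero hy
      have : ‖x - y.1‖ < R := not_le.1 this
      rw [Metric.mem_closedBall, dist_comm, dist_eq_norm]
      exact this.le
    have hs3 := hs1.add hs2
    refine (hs3.congr fun y => ?_).of_abs
    exact (congrFun (Set.indicator_self_add_compl D fun v => |(φ v).toReal|) (x - y.1))
  have hfin : ∀ y ∈ γ.1, φ (x - y) ≠ ⊤ := fun y hy =>
    h.pp.finite_off _ (sub_ne_zero.2 fun hxy => hx (hxy ▸ hy))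
  rw [energy, if_pos ⟨hfin, hs⟩]
  exact EReal.coe_ne_top _

end GibbsEstimates

section Fubini

variable {X Y G : Type*} [MeasurableSpace X] [MeasurableSpace Y] [MeasurableSpace G]
  {mX : Measure X} {mY : Measure Y} {mG : Measure G}

lemma integral_toReal_sub_toReal {P N : X → ℝ≥0∞} (hP : Measurable P)
    (hN : Measurable N) {g : Y → ℝ} (hg : Integrable g mY)
    (hPg : ∫⁻ x, P x ∂mX = ∫⁻ y, ENNReal.ofReal (g y) ∂mY)
    (hNg : ∫⁻ x, N x ∂mX = ∫⁻ y, ENNReal.ofReal (-g y) ∂mY) :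
    Integrable (fun x => (P x).toReal - (N x).toReal) mX ∧
      ∫ x, ((P x).toReal - (N x).toReal) ∂mX = ∫ y, g y ∂mY := by
  have hP' : ∫⁻ x, P x ∂mX ≠ ⊤ := by
    rw [hPg]
    exact (lt_of_le_of_lt (lintegral_mono fun y => Real.ofReal_le_enorm _) hg.2).ne
  have hN' : ∫⁻ x, N x ∂mX ≠ ⊤ := by
    rw [hNg]
    exact (lt_of_le_of_lt (lintegral_mono fun y => Real.ofReal_le_enorm _) hg.neg.2).ne
  have iP := integrable_toReal_of_lintegral_ne_top hP.aemeasurable hP'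
  have iN := integrable_toReal_of_lintegral_ne_top hN.aemeasurable hN'
  refine ⟨iP.sub iN, ?_⟩
  rw [integral_sub iP iN, integral_toReal hP.aemeasurable (ae_lt_top hP hP'),
    integral_toReal hN.aemeasurable (ae_lt_top hN hN'), hPg, hNg,
    integral_eq_lintegral_pos_part_sub_lintegral_neg_part hg]

variable [SFinite mY] [SFinite mG]

lemma integrable_mul_of_lintegral_le {b : X × Y → ℝ} (hb : Integrable b (mX.prod mY))
    (hbm : Measurable b) {W : X × (Y × G) → ℝ} (hW : Measurable W) {C : ℝ≥0∞} (hC : C ≠ ⊤)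
    (hWC : ∀ x y, ∫⁻ g, ‖W (x, (y, g))‖ₑ ∂mG ≤ C) :
    Integrable (fun p : X × (Y × G) => b (p.1, p.2.1) * W p) (mX.prod (mY.prod mG)) := by
  have hm : Measurable fun p : X × (Y × G) => b (p.1, p.2.1) * W p := by fun_prop
  refine ⟨hm.aestronglyMeasurable, ?_⟩
  rw [HasFiniteIntegral, lintegral_prod _ hm.enorm.aemeasurable]
  calc ∫⁻ x, ∫⁻ q, ‖b (x, q.1) * W (x, q)‖ₑ ∂mY.prod mG ∂mX
      = ∫⁻ x, ∫⁻ y, ∫⁻ g, ‖b (x, y) * W (x, (y, g))‖ₑ ∂mG ∂mY ∂mX := by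
        refine lintegral_congr fun x => ?_
        rw [lintegral_prod _ (by fun_prop)]
    _ ≤ ∫⁻ x, ∫⁻ y, C * ‖b (x, y)‖ₑ ∂mY ∂mX := by
        refine lintegral_mono fun x => lintegral_mono fun y => ?_
        simp only [enorm_mul]
        rw [lintegral_const_mul _ (by fun_prop), mul_comm]
        gcongr
        exact hWC x y
    _ = C * ∫⁻ p, ‖b p‖ₑ ∂mX.prod mY := by
        rw [lintegral_prod _ (by fun_prop), ← lintegral_const_mul _ (by fun_prop)]
        refine lintegral_congr fun x => ?_
        rw [lintegral_const_mul _ (by fun_prop)]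
    _ < ⊤ := ENNReal.mul_lt_top hC.lt_top hb.2

variable [SFinite mX]

lemma measurePreserving_prod_assoc_swap : MeasurePreserving
    (fun p : (X × G) × Y => (p.1.1, (p.2, p.1.2))) ((mX.prod mG).prod mY)
    (mX.prod (mY.prod mG)) := by
  have h1 := measurePreserving_prodAssoc mX mG mY
  have h2 := (MeasurePreserving.id mX).prod
    (Measure.measurePreserving_swap (μ := mG) (ν := mY))
  exact h2.comp h1

lemma integrable_integral_of_ae_eq {T : (X × G) × Y → ℝ} {S : X × (Y × G) → ℝ} (hT : Measurable T)
    (hS : Measurable S) (hSi : Integrable S (mX.prod (mY.prod mG)))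
    (hTS : ∀ᵐ x ∂mX, ∀ᵐ y ∂mY, ∀ᵐ g ∂mG, T ((x, g), y) = S (x, (y, g))) :
    Integrable (fun p => ∫ y, T (p, y) ∂mY) (mX.prod mG) ∧
    Integrable (fun q : X × Y => ∫ g, S (q.1, (q.2, g)) ∂mG) (mX.prod mY) ∧
      ∫ p, ∫ y, T (p, y) ∂mY ∂(mX.prod mG) =
        ∫ q : X × Y, ∫ g, S (q.1, (q.2, g)) ∂mG ∂(mX.prod mY) := by
  have hmp := measurePreserving_prod_assoc_swap (mX := mX) (mY := mY) (mG := mG)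
  have hae' : ∀ᵐ p ∂(mX.prod (mY.prod mG)), T ((p.1, p.2.2), p.2.1) = S p := by
    rw [Measure.ae_prod_iff_ae_ae (measurableSet_eq_fun (by fun_prop) hS)]
    filter_upwards [hTS] with x hx
    rw [Measure.ae_prod_iff_ae_ae (measurableSet_eq_fun (by fun_prop) (by fun_prop))]
    exact hx
  have hae : T =ᵐ[(mX.prod mG).prod mY] fun p => S (p.1.1, (p.2, p.1.2)) :=
    hmp.quasiMeasurePreserving.ae hae'
  have hTi : Integrable T ((mX.prod mG).prod mY) :=
    (hmp.integrable_comp_of_integrable hSi).congr hae.symm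
  have h1 := measurePreserving_prodAssoc mX mY mG
  have hSi' : Integrable (fun q : (X × Y) × G => S (q.1.1, (q.1.2, q.2)))
      ((mX.prod mY).prod mG) := h1.integrable_comp_of_integrable hSi
  refine ⟨hTi.integral_prod_left, hSi'.integral_prod_left, ?_⟩
  rw [← integral_prod _ hTi, integral_congr_ae hae,
    ← integral_prod (fun q : (X × Y) × G => S (q.1.1, (q.1.2, q.2))) hSi',
    ← integral_map (φ := fun p : (X × G) × Y => (p.1.1, (p.2, p.1.2))) hmp.aemeasurable
      (by rw [hmp.map_eq]; exact hS.aestronglyMeasurable), hmp.map_eq,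
    ← integral_map (φ := fun q : (X × Y) × G => (q.1.1, (q.1.2, q.2))) h1.aemeasurable
      (by exact hS.aestronglyMeasurable)]
  congr 1
  exact h1.map_eq.symm

lemma integral_prod_prod_right {Z : Type*} [MeasurableSpace Z] {mZ : Measure Z} [SFinite mZ]
    {h : X × (Y × Z) → ℝ} (hh : Integrable h (mX.prod (mY.prod mZ))) :
    ∫ p, h p ∂(mX.prod (mY.prod mZ)) = ∫ x, ∫ y, ∫ w, h (x, (y, w)) ∂mZ ∂mY ∂mX := by
  rw [integral_prod _ hh]
  refine integral_congr_ae ?_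
  filter_upwards [hh.prod_right_ae] with x hx
  exact integral_prod _ hx

lemma integral_prod_prod_prod {V Z : Type*} [MeasurableSpace V] [MeasurableSpace Z]
    {mV : Measure V} {mZ : Measure Z} [SFinite mV] [SFinite mZ]
    {h : (V × X) × (Y × Z) → ℝ} (hh : Integrable h ((mV.prod mX).prod (mY.prod mZ))) :
    ∫ p, h p ∂((mV.prod mX).prod (mY.prod mZ)) =
      ∫ v, ∫ x, ∫ y, ∫ w, h ((v, x), (y, w)) ∂mZ ∂mY ∂mX ∂mV := by
  rw [integral_prod_prod_right hh]
  have h1 : (fun x => ∫ y, ∫ w, h (x, (y, w)) ∂mZ ∂mY) =ᵐ[mV.prod mX]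
      fun x => ∫ q, h (x, q) ∂(mY.prod mZ) := by
    filter_upwards [hh.prod_right_ae] with x hx
    exact (integral_prod _ hx).symm
  exact integral_prod _ (hh.integral_prod_left.congr h1.symm)

end Fubini

section NguyenZessin

variable {d : ℕ} {z : ℝ} {φ : EucSp d → EReal} {μ : Measure (Config d)}

/-- The Papangelou intensity `z exp(-E(x,γ))`. -/
def papangelou (z : ℝ) (φ : EucSp d → EReal) (x : EucSp d) (γ : Config d) : ℝ≥0∞ :=
  ENNReal.ofReal z * eexp (-(energy φ x γ.1))

lemma measurable_papangelou (hφ : Measurable φ) :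
    Measurable fun p : EucSp d × Config d => papangelou z φ p.1 p.2 :=
  (measurable_eexp.comp (measurable_energy hφ).neg).const_mul _

lemma papangelou_ne_top (x : EucSp d) (γ : Config d) : papangelou z φ x γ ≠ ⊤ := by
  refine ENNReal.mul_ne_top ENNReal.ofReal_ne_top ?_
  have h := energy_ne_bot (φ := φ) x γ.1
  induction hE : energy φ x γ.1 with
  | bot => exact absurd hE h
  | top => simp [eexp_bot]
  | coe r =>
    rw [← EReal.coe_neg, eexp_coe]
    exact ENNReal.ofReal_ne_top

lemma papangelou_toReal (hz : 0 ≤ z) {x : EucSp d} {γ : Config d} {r : ℝ}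
    (h : energy φ x γ.1 = r) : (papangelou z φ x γ).toReal = z * Real.exp (-r) := by
  rw [papangelou, h, ← EReal.coe_neg, eexp_coe, ENNReal.toReal_mul, ENNReal.toReal_ofReal hz,
    ENNReal.toReal_ofReal (Real.exp_pos _).le]

lemma papangelou_mul_ofReal (x : EucSp d) (γ : Config d) (r : ℝ) :
    papangelou z φ x γ * ENNReal.ofReal r = ENNReal.ofReal ((papangelou z φ x γ).toReal * r) := by
  rw [ENNReal.ofReal_mul ENNReal.toReal_nonneg, ENNReal.ofReal_toReal (papangelou_ne_top x γ)]

lemma Config.measurable_ins_comp {Ω : Type*} [MeasurableSpace Ω] {g : Ω → Config d}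
    {x : Ω → EucSp d} (hg : Measurable g) (hx : Measurable x) :
    Measurable fun ω => (g ω).ins (x ω) :=
  Config.measurable_ins.comp (hg.prodMk hx)

variable [SFinite μ]

lemma GNZ.lintegral_tsum (h : GNZ z φ μ) (hφ : Measurable φ) {G : Config d → EucSp d → ℝ≥0∞}
    (hG : Measurable (Function.uncurry G)) :
    ∫⁻ γ, ∑' x : γ.1, G γ x.1 ∂μ = ∫⁻ q : EucSp d × Config d,
      papangelou z φ q.1 q.2 * G (q.2.ins q.1) q.1 ∂(volume.prod μ) := by
  rw [h G hG, lintegral_prod_symm]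
  · rfl
  · exact ((measurable_papangelou hφ).mul (hG.comp
      ((Config.measurable_ins_comp measurable_snd measurable_fst).prodMk
        measurable_fst))).aemeasurable

lemma GNZ.lintegral_tsum_tsum (h : GNZ z φ μ) (hφ : Measurable φ)
    {G : Config d → EucSp d → EucSp d → ℝ≥0∞}
    (hG : Measurable fun p : Config d × EucSp d × EucSp d => G p.1 p.2.1 p.2.2)
    (hG0 : ∀ γ x, G γ x x = 0) :
    ∫⁻ γ, ∑' x : γ.1, ∑' y : γ.1, G γ x.1 y.1 ∂μ =
      ∫⁻ q : (EucSp d × EucSp d) × Config d, papangelou z φ q.1.2 q.2 *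
        (papangelou z φ q.1.1 (q.2.ins q.1.2) * G ((q.2.ins q.1.2).ins q.1.1) q.1.1 q.1.2)
        ∂((volume.prod volume).prod μ) := by
  have hp := measurable_papangelou (z := z) hφ
  have hp' : ∀ {Ω : Type} [MeasurableSpace Ω] {x : Ω → EucSp d} {g : Ω → Config d},
      Measurable x → Measurable g → Measurable fun ω => papangelou z φ (x ω) (g ω) :=
    fun hx hg => hp.comp (hx.prodMk hg)
  have hG' : ∀ {Ω : Type} [MeasurableSpace Ω] {x y : Ω → EucSp d} {g : Ω → Config d},
      Measurable g → Measurable x → Measurable y → Measurable fun ω => G (g ω) (x ω) (y ω) :=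
    fun hg hx hy => hG.comp (hg.prodMk (hx.prodMk hy))
  have hins : ∀ (γ : Config d) x, ∑' y : (γ.ins x).1, G (γ.ins x) x y.1 =
      ∑' y : γ.1, G (γ.ins x) x y.1 := fun γ x => by
    rw [tsum_subtype (γ.ins x).1 (fun y => G (γ.ins x) x y),
      tsum_subtype γ.1 (fun y => G (γ.ins x) x y)]
    refine tsum_congr fun y => ?_
    rcases eq_or_ne y x with rfl | hy
    · simp [Set.indicator_apply, hG0]
    · simp [Set.indicator_apply, Config.ins, hy]
  rw [h.lintegral_tsum hφ (G := fun γ x => ∑' y : γ.1, G γ x y.1)]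
  swap
  · exact Config.measurable_tsum measurable_fst
      (h := fun (p : Config d × EucSp d) y => G p.1 p.2 y)
      (hG' measurable_fst.fst measurable_fst.snd measurable_snd)
  simp only [hins]
  rw [lintegral_prod]
  swap
  · refine Measurable.aemeasurable (hp.mul ?_)
    exact Config.measurable_tsum measurable_snd
      (h := fun (q : EucSp d × Config d) y => G (q.2.ins q.1) q.1 y)
      (hG' (Config.measurable_ins_comp measurable_fst.snd measurable_fst.fst)
        measurable_fst.fst measurable_snd)
  have hm2 : Measurable fun q : (EucSp d × EucSp d) × Config d => papangelou z φ q.1.2 q.2 *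
      (papangelou z φ q.1.1 (q.2.ins q.1.2) * G ((q.2.ins q.1.2).ins q.1.1) q.1.1 q.1.2) := by
    have i1 := Config.measurable_ins_comp (d := d)
      (measurable_snd : Measurable (Prod.snd : (EucSp d × EucSp d) × Config d → _))
      measurable_fst.snd
    exact (hp' measurable_fst.snd measurable_snd).mul ((hp' measurable_fst.fst i1).mul
      (hG' (Config.measurable_ins_comp i1 measurable_fst.fst) measurable_fst.fst
        measurable_fst.snd))
  rw [lintegral_prod _ hm2.aemeasurable, lintegral_prod _ hm2.lintegral_prod_right'.aemeasurable]
  refine lintegral_congr fun x => ?_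
  simp only [← ENNReal.tsum_mul_left]
  have hmx : Measurable fun p : Config d × EucSp d =>
      papangelou z φ x p.1 * G (p.1.ins x) x p.2 :=
    (hp' measurable_const measurable_fst).mul
      (hG' (Config.measurable_ins_comp measurable_fst measurable_const) measurable_const
        measurable_snd)
  rw [h.lintegral_tsum hφ (G := fun γ y => papangelou z φ x γ * G (γ.ins x) x y) hmx,
    lintegral_prod]
  exact ((hp' measurable_fst measurable_snd).mul (hmx.comp
    ((Config.measurable_ins_comp measurable_snd measurable_fst).prodMk
      measurable_fst))).aemeasurable

lemma GNZ.integral_tsum (h : GNZ z φ μ) (hφ : Measurable φ) {G : Config d → EucSp d → ℝ}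
    (hG : Measurable (Function.uncurry G)) (hs : ∀ γ : Config d, Summable fun x : γ.1 => G γ x.1)
    (hint : Integrable (fun q : EucSp d × Config d =>
      (papangelou z φ q.1 q.2).toReal * G (q.2.ins q.1) q.1) (volume.prod μ)) :
    Integrable (fun γ => ∑' x : γ.1, G γ x.1) μ ∧ ∫ γ, ∑' x : γ.1, G γ x.1 ∂μ =
      ∫ q : EucSp d × Config d,
        (papangelou z φ q.1 q.2).toReal * G (q.2.ins q.1) q.1 ∂(volume.prod μ) := by
  have e : ∀ γ : Config d, ∑' x : γ.1, G γ x.1 = (∑' x : γ.1, ENNReal.ofReal (G γ x.1)).toReal -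
      (∑' x : γ.1, ENNReal.ofReal (-G γ x.1)).toReal := fun γ => (hs γ).tsum_eq_toReal_sub
  simp only [e]
  refine integral_toReal_sub_toReal ?_ ?_ hint ?_ ?_
  · exact Config.measurable_tsum measurable_id (h := fun γ x => ENNReal.ofReal (G γ x))
      hG.ennreal_ofReal
  · exact Config.measurable_tsum measurable_id (h := fun γ x => ENNReal.ofReal (-G γ x))
      hG.neg.ennreal_ofReal
  · rw [h.lintegral_tsum hφ (G := fun γ x => ENNReal.ofReal (G γ x)) hG.ennreal_ofReal]
    exact lintegral_congr fun q => papangelou_mul_ofReal _ _ _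
  · rw [h.lintegral_tsum hφ (G := fun γ x => ENNReal.ofReal (-G γ x)) hG.neg.ennreal_ofReal]
    refine lintegral_congr fun q => ?_
    rw [papangelou_mul_ofReal, mul_neg]

lemma GNZ.integral_tsum_prod (h : GNZ z φ μ) (hφ : Measurable φ)
    {G : Config d → EucSp d → EucSp d → ℝ}
    (hG : Measurable fun p : Config d × EucSp d × EucSp d => G p.1 p.2.1 p.2.2)
    (hG0 : ∀ γ x, G γ x x = 0)
    (hs : ∀ γ : Config d, Summable fun p : γ.1 × γ.1 => G γ p.1.1 p.2.1)
    (hint : Integrable (fun q : (EucSp d × EucSp d) × Config d =>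
      (papangelou z φ q.1.2 q.2).toReal * ((papangelou z φ q.1.1 (q.2.ins q.1.2)).toReal *
        G ((q.2.ins q.1.2).ins q.1.1) q.1.1 q.1.2)) ((volume.prod volume).prod μ)) :
    Integrable (fun γ => ∑' p : γ.1 × γ.1, G γ p.1.1 p.2.1) μ ∧
      ∫ γ, ∑' p : γ.1 × γ.1, G γ p.1.1 p.2.1 ∂μ =
      ∫ q : (EucSp d × EucSp d) × Config d,
        (papangelou z φ q.1.2 q.2).toReal * ((papangelou z φ q.1.1 (q.2.ins q.1.2)).toReal *
          G ((q.2.ins q.1.2).ins q.1.1) q.1.1 q.1.2) ∂((volume.prod volume).prod μ) := by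
  have e : ∀ γ : Config d, ∑' p : γ.1 × γ.1, G γ p.1.1 p.2.1 =
      (∑' x : γ.1, ∑' y : γ.1, ENNReal.ofReal (G γ x.1 y.1)).toReal -
      (∑' x : γ.1, ∑' y : γ.1, ENNReal.ofReal (-G γ x.1 y.1)).toReal := fun γ => by
    rw [(hs γ).tsum_eq_toReal_sub, ENNReal.tsum_prod', ENNReal.tsum_prod']
  have hmeas : ∀ {F : Config d → EucSp d → EucSp d → ℝ≥0∞},
      (Measurable fun p : Config d × EucSp d × EucSp d => F p.1 p.2.1 p.2.2) →
      Measurable fun γ : Config d => ∑' x : γ.1, ∑' y : γ.1, F γ x.1 y.1 := fun {F} hF =>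
    Config.measurable_tsum measurable_id (h := fun γ x => ∑' y : γ.1, F γ x y.1)
      (Config.measurable_tsum measurable_fst (h := fun (p : Config d × EucSp d) y => F p.1 p.2 y)
        (hF.comp (measurable_fst.fst.prodMk (measurable_fst.snd.prodMk measurable_snd))))
  simp only [e]
  refine integral_toReal_sub_toReal (hmeas (F := fun γ x y => ENNReal.ofReal (G γ x y)) hG.ennreal_ofReal)
    (hmeas (F := fun γ x y => ENNReal.ofReal (-G γ x y)) hG.neg.ennreal_ofReal) hint ?_ ?_
  · rw [h.lintegral_tsum_tsum hφ (G := fun γ x y => ENNReal.ofReal (G γ x y)) hG.ennreal_ofReal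
      (by simp [hG0])]
    refine lintegral_congr fun q => ?_
    rw [papangelou_mul_ofReal, papangelou_mul_ofReal]
  · rw [h.lintegral_tsum_tsum hφ (G := fun γ x y => ENNReal.ofReal (-G γ x y))
      hG.neg.ennreal_ofReal (by simp [hG0])]
    refine lintegral_congr fun q => ?_
    rw [papangelou_mul_ofReal, papangelou_mul_ofReal, mul_neg, mul_neg]

end NguyenZessin

section DeathKernel

variable {d : ℕ} {s z ε : ℝ} {a : EucSp d → ℝ} {φ : EucSp d → EReal} {f : EucSp d → ℝ}

/-- The integrand of the summand of `HepsMinus` belonging to the point `x`, after rescaling the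
jump variable. -/
def deathKernel (s ε : ℝ) (a : EucSp d → ℝ) (φ : EucSp d → EReal) (f : EucSp d → ℝ)
    (γ : Config d) (x y : EucSp d) : ℝ :=
  (Real.exp (f x) - 1) * Real.exp (cpair f (γ.del x)) *
    (a y * rexp ((s : EReal) * energy φ x (γ.del x).1 +
      ((s - 1 : ℝ) : EReal) * energy φ (ε⁻¹ • y + x) (γ.del x).1))

/-- The summand of `HepsMinus` belonging to the point `x`. -/
def deathTerm (s ε : ℝ) (a : EucSp d → ℝ) (φ : EucSp d → EReal) (f : EucSp d → ℝ)
    (γ : Config d) (x : EucSp d) : ℝ := ∫ y, deathKernel s ε a φ f γ x y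

lemma measurable_energy_comp {Ω : Type*} [MeasurableSpace Ω] (hφ : Measurable φ)
    {x : Ω → EucSp d} {g : Ω → Config d} (hx : Measurable x) (hg : Measurable g) :
    Measurable fun ω => energy φ (x ω) (g ω).1 :=
  (measurable_energy hφ).comp (hx.prodMk hg)

lemma measurable_deathKernel (hφ : Measurable φ) (ha : Measurable a) (hf : IsC0 f) :
    Measurable fun p : Config d × EucSp d × EucSp d => deathKernel s ε a φ f p.1 p.2.1 p.2.2 := by
  have hd : Measurable fun p : Config d × EucSp d × EucSp d => p.1.del p.2.1 :=
    Config.measurable_del.comp (measurable_fst.prodMk measurable_snd.fst)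
  have hfm := hf.1.measurable
  refine Measurable.mul (Measurable.mul (by fun_prop)
    (Real.measurable_exp.comp ((measurable_cpair hfm hf.2).comp hd))) (Measurable.mul (by fun_prop)
      (measurable_rexp.comp (Measurable.add ?_ ?_)))
  · exact measurable_const.mul (measurable_energy_comp hφ (by fun_prop) hd)
  · exact measurable_const.mul (measurable_energy_comp hφ (by fun_prop) hd)

lemma deathKernel_eq_zero {γ : Config d} {x y : EucSp d} (hx : f x = 0) :
    deathKernel s ε a φ f γ x y = 0 := by simp [deathKernel, hx]

lemma Config.del_ins {γ : Config d} {x : EucSp d} (hx : x ∉ γ.1) : (γ.ins x).del x = γ :=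
  Subtype.ext (by simp [Config.ins, Config.del, hx])

lemma Config.ins_comm (γ : Config d) (x y : EucSp d) : (γ.ins x).ins y = (γ.ins y).ins x :=
  Subtype.ext (Set.insert_comm _ _ _)

lemma cpair_ins (hf : HasCompactSupport f) {γ : Config d} {x : EucSp d} (hx : x ∉ γ.1) :
    cpair f (γ.ins x) = f x + cpair f γ := by
  have h0 : HasSum (fun y : ({x} : Set (EucSp d)) => f y.1) (f x) := by
    simpa using hasSum_fintype (fun y : ({x} : Set (EucSp d)) => f y.1)
  have h := HasSum.add_disjoint (f := f) (Set.disjoint_singleton_left.2 hx) h0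
    (γ.summable hf).hasSum
  rw [← Set.insert_eq] at h
  exact h.tsum_eq

lemma Config.ins_del {γ : Config d} {x : EucSp d} (hx : x ∈ γ.1) : (γ.del x).ins x = γ :=
  Subtype.ext (by simp [Config.ins, Config.del, hx])

lemma Config.notMem_del (γ : Config d) (x : EucSp d) : x ∉ (γ.del x).1 := fun h => h.2 rfl

lemma HepsMinus_aScaled_exp (hε : 0 < ε) (ha : ∀ x, a (-x) = a x) (hf : HasCompactSupport f)
    (γ : Config d) :
    HepsMinus s (aScaled a ε) φ (fun γ' => Real.exp (cpair f γ')) γ =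
      ∑' x : γ.1, deathTerm s ε a φ f γ x.1 := by
  rw [HepsMinus, ← tsum_neg]
  refine tsum_congr fun x => ?_
  have h1 : Dminus (fun γ' => Real.exp (cpair f γ')) x.1 γ =
      -((Real.exp (f x.1) - 1) * Real.exp (cpair f (γ.del x.1))) := by
    have h := cpair_ins hf (γ.notMem_del x.1)
    rw [Config.ins_del x.2] at h
    simp only [Dminus, h, Real.exp_add]
    ring
  simp only [deathTerm, deathKernel]
  rw [integral_const_mul, h1, neg_mul, neg_neg]
  congr 1
  set R : EucSp d → ℝ := fun y => rexp ((s : EReal) * energy φ x.1 (γ.del x.1).1 +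
      ((s - 1 : ℝ) : EReal) * energy φ y (γ.del x.1).1) with hR
  set g : EucSp d → ℝ := fun y => a y * R (ε⁻¹ • y + x.1) with hg
  have e : ∀ y, aScaled a ε (x.1 - y) * R y = ε ^ d * g (ε • (y - x.1)) := fun y => by
    simp only [aScaled, hg]
    rw [smul_smul, inv_mul_cancel₀ hε.ne', one_smul, sub_add_cancel, ← ha, ← smul_neg, neg_sub]
    ring
  calc ∫ y, aScaled a ε (x.1 - y) * R y = ∫ y, ε ^ d * g (ε • (y - x.1)) := by simp only [e]
    _ = ε ^ d * ∫ y, g (ε • y) := by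
      rw [integral_const_mul, integral_sub_right_eq_self (fun y => g (ε • y))]
    _ = ∫ y, g y := by
      rw [Measure.integral_comp_smul_of_nonneg _ _ _ (hR := hε.le)]
      simp [hε.ne']

lemma finite_support_deathTerm (hf : HasCompactSupport f) (γ : Config d) :
    (Function.support fun x : γ.1 => deathTerm s ε a φ f γ x.1).Finite := by
  refine (γ.finite_support hf).subset fun x hx hfx => hx ?_
  simp [deathTerm, deathKernel_eq_zero hfx]

end DeathKernel

lemma sq_tsum_eq_of_finite_support {ι : Type*} {c : ι → ℝ} (hc : (Function.support c).Finite) :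
    (∑' i, c i) ^ 2 = ∑' i, c i ^ 2 + ∑' p : ι × ι, if p.1 = p.2 then 0 else c p.1 * c p.2 := by
  have hs : Summable c := summable_of_hasFiniteSupport hc
  have hp : (Function.support fun p : ι × ι => c p.1 * c p.2).Finite :=
    (hc.prod hc).subset fun p hp => ⟨left_ne_zero_of_mul hp, right_ne_zero_of_mul hp⟩
  have hd : (Function.support fun p : ι × ι => if p.1 = p.2 then c p.1 * c p.2 else 0).Finite :=
    hp.subset fun p hp' h => hp' (by simp only at h; simp [h])
  have ho : (Function.support fun p : ι × ι => if p.1 = p.2 then 0 else c p.1 * c p.2).Finite :=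
    hp.subset fun p hp' h => hp' (by simp only at h; simp [h])
  have h1 : ∑' p : ι × ι, (if p.1 = p.2 then c p.1 * c p.2 else 0) = ∑' i, c i ^ 2 := by
    rw [(summable_of_hasFiniteSupport hd).tsum_prod' fun i =>
      summable_of_hasFiniteSupport ((Set.finite_singleton i).subset fun j hj => by
        by_contra h; exact hj (by simp [Ne.symm h]))]
    refine tsum_congr fun i => ?_
    rw [tsum_eq_single i fun j hj => by simp [hj.symm]]
    simp [sq]
  rw [← h1, ← (summable_of_hasFiniteSupport hd).tsum_add (summable_of_hasFiniteSupport ho), sq,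
    hs.tsum_mul_tsum hs (summable_of_hasFiniteSupport hp)]
  refine tsum_congr fun p => ?_
  split_ifs <;> simp

section Weights

variable {d : ℕ} {s z B ξ ε : ℝ} {a : EucSp d → ℝ} {φ : EucSp d → EReal} {f : EucSp d → ℝ}
  {μ : Measure (Config d)} {k u : ∀ n : ℕ, (Fin n → EucSp d) → ℝ}

lemma Setting.exists_lintegral_enorm_rexp_le (h : Setting d s z B ξ φ μ k u) (hf : IsC0 f) :
    ∃ C : ℝ≥0∞, C ≠ ⊤ ∧ ∀ (t₁ t₂ t₃ t₄ : ℝ) (x₁ x₂ x₃ x₄ : EucSp d),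
      t₁ ∈ Set.Icc (-1) 0 → t₂ ∈ Set.Icc (-1) 0 → t₃ ∈ Set.Icc (-1) 0 → t₄ ∈ Set.Icc (-1) 0 →
      ∫⁻ γ, ‖rexp ((t₁ : EReal) * energy φ x₁ γ.1 + (t₂ : EReal) * energy φ x₂ γ.1 +
        (t₃ : EReal) * energy φ x₃ γ.1 + (t₄ : EReal) * energy φ x₄ γ.1 +
        ((2 * cpair f γ : ℝ) : EReal))‖ₑ ∂μ ≤ C := by
  obtain ⟨C, hC, hCb⟩ := h.exists_lintegral_domExp_le hf
  refine ⟨C, hC, fun t₁ t₂ t₃ t₄ x₁ x₂ x₃ x₄ h₁ h₂ h₃ h₄ => ?_⟩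
  refine (lintegral_mono fun γ => ?_).trans (hCb ![x₁, x₂, x₃, x₄])
  rw [Real.enorm_eq_ofReal (rexp_nonneg _)]
  refine ofReal_rexp_le ?_
  rw [domExp_eq, Fin.sum_univ_four]
  simp only [EReal.coe_ennreal_add]
  exact add_le_add (add_le_add (add_le_add (add_le_add (mul_energy_le h₁.2 h₁.1 _ _)
    (mul_energy_le h₂.2 h₂.1 _ _)) (mul_energy_le h₃.2 h₃.1 _ _)) (mul_energy_le h₄.2 h₄.1 _ _))
    (γ.mul_cpair_le f hf.2)

/-- The integrand of the one-point part of the second moment of `HepsMinus`. -/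
def oneWeight (s ε : ℝ) (φ : EucSp d → EReal) (f : EucSp d → ℝ)
    (p : EucSp d × ((EucSp d × EucSp d) × Config d)) : ℝ :=
  rexp (((2 * s - 1 : ℝ) : EReal) * energy φ p.1 p.2.2.1 +
    ((s - 1 : ℝ) : EReal) * energy φ (ε⁻¹ • p.2.1.1 + p.1) p.2.2.1 +
    ((s - 1 : ℝ) : EReal) * energy φ (ε⁻¹ • p.2.1.2 + p.1) p.2.2.1 +
    ((2 * cpair f p.2.2 : ℝ) : EReal))

/-- The interaction factor between the two points in the two-point part of the second moment of
`HepsMinus`. -/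
def pairWeight (s ε : ℝ) (φ : EucSp d → EReal)
    (p : (EucSp d × EucSp d) × (EucSp d × EucSp d)) : ℝ :=
  rexp (((2 * s - 1 : ℝ) : EReal) * φ (p.1.1 - p.1.2) +
    ((s - 1 : ℝ) : EReal) * φ (ε⁻¹ • p.2.1 + p.1.1 - p.1.2) +
    ((s - 1 : ℝ) : EReal) * φ (ε⁻¹ • p.2.2 + p.1.2 - p.1.1))

/-- The interaction factor with the environment in the two-point part of the second moment of
`HepsMinus`. -/
def twoWeight (s ε : ℝ) (φ : EucSp d → EReal) (f : EucSp d → ℝ)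
    (p : (EucSp d × EucSp d) × ((EucSp d × EucSp d) × Config d)) : ℝ :=
  rexp (((s - 1 : ℝ) : EReal) * energy φ p.1.1 p.2.2.1 +
    ((s - 1 : ℝ) : EReal) * energy φ p.1.2 p.2.2.1 +
    ((s - 1 : ℝ) : EReal) * energy φ (ε⁻¹ • p.2.1.1 + p.1.1) p.2.2.1 +
    ((s - 1 : ℝ) : EReal) * energy φ (ε⁻¹ • p.2.1.2 + p.1.2) p.2.2.1 +
    ((2 * cpair f p.2.2 : ℝ) : EReal))

lemma measurable_oneWeight (hφ : Measurable φ) (hf : IsC0 f) :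
    Measurable (oneWeight s ε φ f) := by
  have hg : Measurable fun p : EucSp d × ((EucSp d × EucSp d) × Config d) => p.2.2 := by fun_prop
  have hc := ((measurable_cpair hf.1.measurable hf.2).comp hg).const_mul 2
  refine measurable_rexp.comp ((((measurable_const.mul ?_).add (measurable_const.mul ?_)).add
    (measurable_const.mul ?_)).add hc.coe_real_ereal)
  all_goals exact measurable_energy_comp hφ (by fun_prop) hg

lemma measurable_pairWeight (hφ : Measurable φ) :
    Measurable (pairWeight (d := d) s ε φ) := by
  refine measurable_rexp.comp (((measurable_const.mul ?_).add (measurable_const.mul ?_)).add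
    (measurable_const.mul ?_))
  all_goals exact hφ.comp (by fun_prop)

lemma measurable_twoWeight (hφ : Measurable φ) (hf : IsC0 f) :
    Measurable (twoWeight s ε φ f) := by
  have hg : Measurable fun p : (EucSp d × EucSp d) × ((EucSp d × EucSp d) × Config d) =>
    p.2.2 := by fun_prop
  have hc := ((measurable_cpair hf.1.measurable hf.2).comp hg).const_mul 2
  refine measurable_rexp.comp (((((measurable_const.mul ?_).add (measurable_const.mul ?_)).add
    (measurable_const.mul ?_)).add (measurable_const.mul ?_)).add hc.coe_real_ereal)
  all_goals exact measurable_energy_comp hφ (by fun_prop) hg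

lemma IsC0.integrable_comp (hf : IsC0 f) {g : ℝ → ℝ} (hg : Continuous g) (hg0 : g 0 = 0) :
    Integrable (fun x => g (f x)) :=
  (hg.comp hf.1).integrable_of_hasCompactSupport (hf.2.comp_left hg0)

lemma Setting.integrable_oneWeight (h : Setting d s z B ξ φ μ k u) (ha : GoodA a) (hf : IsC0 f) :
    Integrable (fun p : EucSp d × ((EucSp d × EucSp d) × Config d) =>
      z * (Real.exp (f p.1) - 1) ^ 2 * a p.2.1.1 * a p.2.1.2 * oneWeight s ε φ f p)
      (volume.prod ((volume.prod volume).prod μ)) := by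
  have := h.prob
  obtain ⟨C, hC, hCb⟩ := h.exists_lintegral_enorm_rexp_le hf
  have hs0 := h.hs0
  have hs1 := h.hs1
  have ham := ha.meas
  have hfm := hf.1.measurable
  have h1 : Integrable (fun p : EucSp d × (EucSp d × EucSp d) =>
      z * (Real.exp (f p.1) - 1) ^ 2 * a p.2.1 * a p.2.2)
      (volume.prod (volume.prod volume)) := by
    have := ((hf.integrable_comp (g := fun t => (Real.exp t - 1) ^ 2) (by fun_prop)
      (by simp)).const_mul z).mul_prod (ha.int.mul_prod ha.int)
    simpa only [mul_assoc] using this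
  refine integrable_mul_of_lintegral_le h1 (by fun_prop) (measurable_oneWeight h.pp.meas hf) hC
    fun x y => ?_
  simpa [oneWeight] using hCb (2 * s - 1) (s - 1) (s - 1) 0 x (ε⁻¹ • y.1 + x) (ε⁻¹ • y.2 + x) x
    ⟨by linarith, by linarith⟩ ⟨by linarith, by linarith⟩ ⟨by linarith, by linarith⟩ (by simp)

lemma Setting.integrable_twoWeight (h : Setting d s z B ξ φ μ k u) (ha : GoodA a) (hf : IsC0 f) :
    Integrable (fun p : (EucSp d × EucSp d) × ((EucSp d × EucSp d) × Config d) =>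
      z * z * Real.exp (f p.1.1) * (Real.exp (f p.1.1) - 1) * Real.exp (f p.1.2) *
        (Real.exp (f p.1.2) - 1) * a p.2.1.1 * a p.2.1.2 *
        (pairWeight s ε φ (p.1, p.2.1) * twoWeight s ε φ f p))
      ((volume.prod volume).prod ((volume.prod volume).prod μ)) := by
  have := h.prob
  obtain ⟨C, hC, hCb⟩ := h.exists_lintegral_enorm_rexp_le hf
  obtain ⟨M, hM⟩ := h.phiNeg_bdd
  have hs0 := h.hs0
  have hs1 := h.hs1
  have ham := ha.meas
  have hfm := hf.1.measurable
  have hφ := h.pp.meas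
  have hpm := measurable_pairWeight (s := s) (ε := ε) hφ
  have htm := measurable_twoWeight (s := s) (ε := ε) hφ hf
  have h1 : Integrable (fun p : (EucSp d × EucSp d) × (EucSp d × EucSp d) =>
      z * z * Real.exp (f p.1.1) * (Real.exp (f p.1.1) - 1) * Real.exp (f p.1.2) *
        (Real.exp (f p.1.2) - 1) * a p.2.1 * a p.2.2)
      ((volume.prod volume).prod (volume.prod volume)) := by
    have hi := hf.integrable_comp (g := fun t => Real.exp t * (Real.exp t - 1)) (by fun_prop)
      (by simp)
    have := ((hi.const_mul (z * z)).mul_prod hi).mul_prod (ha.int.mul_prod ha.int)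
    simpa only [mul_assoc] using this
  refine integrable_mul_of_lintegral_le (C := ENNReal.ofReal (Real.exp (M + M + M)) * C) h1
    (by fun_prop) (W := fun p => pairWeight s ε φ (p.1, p.2.1) * twoWeight s ε φ f p)
    (by fun_prop) (ENNReal.mul_ne_top ENNReal.ofReal_ne_top hC) fun x y => ?_
  simp only [enorm_mul]
  rw [lintegral_const_mul _ (by fun_prop)]
  have ht : ∀ {t : ℝ}, t ≤ 0 → -1 ≤ t → ∀ v, (t : EReal) * φ v ≤ (M : EReal) := fun h0 h1 v =>
    (mul_phi_le h.pp.ne_bot h0 h1 v).trans (EReal.coe_le_coe_iff.2 (hM v))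
  refine mul_le_mul' ?_ ?_
  · rw [pairWeight, Real.enorm_eq_ofReal (rexp_nonneg _)]
    refine ENNReal.ofReal_le_ofReal (rexp_le ?_)
    rw [EReal.coe_add, EReal.coe_add]
    exact add_le_add (add_le_add (ht (by linarith) (by linarith) _)
      (ht (by linarith) (by linarith) _)) (ht (by linarith) (by linarith) _)
  · have hs : s - 1 ∈ Set.Icc (-1 : ℝ) 0 := ⟨by linarith, by linarith⟩
    simpa only [twoWeight] using hCb (s - 1) (s - 1) (s - 1) (s - 1) x.1 x.2 (ε⁻¹ • y.1 + x.1)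
      (ε⁻¹ • y.2 + x.2) hs hs hs hs

lemma papangelou_mul_deathKernel_sq (hz : 0 ≤ z) {x y₁ y₂ : EucSp d} {γ : Config d}
    (hx : x ∉ γ.1) (h0 : energy φ x γ.1 ≠ ⊤) (h1 : energy φ (ε⁻¹ • y₁ + x) γ.1 ≠ ⊤)
    (h2 : energy φ (ε⁻¹ • y₂ + x) γ.1 ≠ ⊤) :
    (papangelou z φ x γ).toReal *
      (deathKernel s ε a φ f (γ.ins x) x y₁ * deathKernel s ε a φ f (γ.ins x) x y₂) =
    z * (Real.exp (f x) - 1) ^ 2 * a y₁ * a y₂ * oneWeight s ε φ f (x, ((y₁, y₂), γ)) := by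
  obtain ⟨r₀, e₀⟩ : ∃ r : ℝ, energy φ x γ.1 = r :=
    ⟨_, (EReal.coe_toReal h0 (energy_ne_bot _ _)).symm⟩
  obtain ⟨r₁, e₁⟩ : ∃ r : ℝ, energy φ (ε⁻¹ • y₁ + x) γ.1 = r :=
    ⟨_, (EReal.coe_toReal h1 (energy_ne_bot _ _)).symm⟩
  obtain ⟨r₂, e₂⟩ : ∃ r : ℝ, energy φ (ε⁻¹ • y₂ + x) γ.1 = r :=
    ⟨_, (EReal.coe_toReal h2 (energy_ne_bot _ _)).symm⟩
  rw [papangelou_toReal hz e₀]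
  simp only [deathKernel, oneWeight, Config.del_ins hx, e₀, e₁, e₂, ← EReal.coe_mul,
    ← EReal.coe_add, rexp_coe]
  have : (2 * s - 1) * r₀ + (s - 1) * r₁ + (s - 1) * r₂ + 2 * cpair f γ =
      -r₀ + cpair f γ + (s * r₀ + (s - 1) * r₁) + cpair f γ + (s * r₀ + (s - 1) * r₂) := by ring
  rw [this]
  simp only [Real.exp_add]
  ring

lemma papangelou_mul_deathKernel_mul (hp : IsPairPotential φ) (hz : 0 ≤ z) (hf : IsC0 f)
    {x₁ x₂ y₁ y₂ : EucSp d} {γ : Config d} (hx : x₁ ≠ x₂) (hx₁ : x₁ ∉ γ.1) (hx₂ : x₂ ∉ γ.1)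
    (hy₁ : ε⁻¹ • y₁ + x₁ ≠ x₂) (hy₂ : ε⁻¹ • y₂ + x₂ ≠ x₁)
    (h1 : energy φ x₁ γ.1 ≠ ⊤) (h2 : energy φ x₂ γ.1 ≠ ⊤)
    (h3 : energy φ (ε⁻¹ • y₁ + x₁) γ.1 ≠ ⊤) (h4 : energy φ (ε⁻¹ • y₂ + x₂) γ.1 ≠ ⊤) :
    (papangelou z φ x₂ γ).toReal * ((papangelou z φ x₁ (γ.ins x₂)).toReal *
      (deathKernel s ε a φ f ((γ.ins x₂).ins x₁) x₁ y₁ *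
        deathKernel s ε a φ f ((γ.ins x₂).ins x₁) x₂ y₂)) =
    z * z * Real.exp (f x₁) * (Real.exp (f x₁) - 1) * Real.exp (f x₂) *
        (Real.exp (f x₂) - 1) * a y₁ * a y₂ *
        (pairWeight s ε φ ((x₁, x₂), (y₁, y₂)) *
          twoWeight s ε φ f ((x₁, x₂), ((y₁, y₂), γ))) := by
  have v0 := hp.finite_off _ (sub_ne_zero.2 hx)
  have v1 := hp.finite_off _ (sub_ne_zero.2 hy₁)
  have v2 := hp.finite_off _ (sub_ne_zero.2 hy₂)
  have hev : φ (x₂ - x₁) = φ (x₁ - x₂) := by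
    rw [← hp.even _ (sub_ne_zero.2 hx), neg_sub]
  have hE : ∀ {x : EucSp d}, energy φ x γ.1 ≠ ⊤ → ∃ r : ℝ, energy φ x γ.1 = r :=
    fun h => ⟨_, (EReal.coe_toReal h (energy_ne_bot _ _)).symm⟩
  have hV : ∀ {v : EucSp d}, φ v ≠ ⊤ → ∃ r : ℝ, φ v = r :=
    fun h => ⟨_, (EReal.coe_toReal h (hp.ne_bot _)).symm⟩
  have i1 : energy φ x₁ (γ.ins x₂).1 = _ := energy_insert hp.ne_bot hx₂ h1 v0
  have i2 : energy φ x₂ (γ.ins x₁).1 = _ := energy_insert hp.ne_bot hx₁ h2 (hev ▸ v0)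
  have i3 : energy φ (ε⁻¹ • y₁ + x₁) (γ.ins x₂).1 = _ := energy_insert hp.ne_bot hx₂ h3 v1
  have i4 : energy φ (ε⁻¹ • y₂ + x₂) (γ.ins x₁).1 = _ := energy_insert hp.ne_bot hx₁ h4 v2
  obtain ⟨r₁, e₁⟩ := hE h1
  obtain ⟨r₂, e₂⟩ := hE h2
  obtain ⟨r₃, e₃⟩ := hE h3
  obtain ⟨r₄, e₄⟩ := hE h4
  obtain ⟨p₀, e₅⟩ := hV v0
  obtain ⟨p₁, e₆⟩ := hV v1
  obtain ⟨p₂, e₇⟩ := hV v2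
  rw [e₁, e₅, ← EReal.coe_add] at i1
  rw [hev, e₂, e₅, ← EReal.coe_add] at i2
  rw [e₃, e₆, ← EReal.coe_add] at i3
  rw [e₄, e₇, ← EReal.coe_add] at i4
  have d1 : ((γ.ins x₂).ins x₁).del x₁ = γ.ins x₂ := Config.del_ins (by
    rintro (h | h)
    exacts [hx h, hx₁ h])
  have d2 : ((γ.ins x₂).ins x₁).del x₂ = γ.ins x₁ := by
    rw [Config.ins_comm]
    refine Config.del_ins ?_
    rintro (h | h)
    exacts [hx h.symm, hx₂ h]
  rw [papangelou_toReal hz e₂, papangelou_toReal hz i1]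
  simp only [deathKernel, pairWeight, twoWeight, d1, d2, i1, i2, i3, i4, e₁, e₂, e₃, e₄, e₅, e₆,
    e₇, cpair_ins hf.2 hx₁, cpair_ins hf.2 hx₂, ← EReal.coe_mul, ← EReal.coe_add, rexp_coe]
  rw [← Real.exp_add ((2 * s - 1) * p₀ + _ + _)]
  have : (2 * s - 1) * p₀ + (s - 1) * p₁ + (s - 1) * p₂ + ((s - 1) * r₁ + (s - 1) * r₂ +
      (s - 1) * r₃ + (s - 1) * r₄ + 2 * cpair f γ) =
      -r₂ + -(r₁ + p₀) + cpair f γ + (s * (r₁ + p₀) + (s - 1) * (r₃ + p₁)) + cpair f γ +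
        (s * (r₂ + p₀) + (s - 1) * (r₄ + p₂)) := by ring
  rw [this]
  simp only [Real.exp_add]
  ring

end Weights

section SecondMoment

variable {d : ℕ} {s z B ξ ε : ℝ} {a : EucSp d → ℝ} {φ : EucSp d → EReal} {f : EucSp d → ℝ}
  {μ : Measure (Config d)} {k u : ∀ n : ℕ, (Fin n → EucSp d) → ℝ}

lemma measurable_deathTerm (hφ : Measurable φ) (ha : Measurable a) (hf : IsC0 f) :
    Measurable fun p : Config d × EucSp d => deathTerm s ε a φ f p.1 p.2 := by
  have h : Measurable fun q : (Config d × EucSp d) × EucSp d =>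
      deathKernel s ε a φ f q.1.1 q.1.2 q.2 :=
    (measurable_deathKernel hφ ha hf).comp
      (measurable_fst.fst.prodMk (measurable_fst.snd.prodMk measurable_snd))
  exact h.stronglyMeasurable.integral_prod_right'.measurable

lemma Setting.tsum_deathTerm_sq (h : Setting d s z B ξ φ μ k u) (ha : GoodA a) (hf : IsC0 f) :
    Integrable (fun γ => ∑' x : γ.1, deathTerm s ε a φ f γ x.1 ^ 2) μ ∧
      ∫ γ, ∑' x : γ.1, deathTerm s ε a φ f γ x.1 ^ 2 ∂μ =
        ∫ x, ∫ y₁, ∫ y₂, z * (Real.exp (f x) - 1) ^ 2 * a y₁ * a y₂ *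
          ∫ γ, oneWeight s ε φ f (x, ((y₁, y₂), γ)) ∂μ := by
  have := h.prob
  have hφ := h.pp.meas
  have hd := Config.measurable_ins_comp (d := d) (Ω := (EucSp d × Config d) × (EucSp d × EucSp d))
    (g := fun p => p.1.2) (x := fun p => p.1.1) (by fun_prop) (by fun_prop)
  have hk := measurable_deathKernel (s := s) (ε := ε) hφ ha.meas hf
  have hT : Measurable fun p : (EucSp d × Config d) × (EucSp d × EucSp d) =>
      (papangelou z φ p.1.1 p.1.2).toReal * (deathKernel s ε a φ f (p.1.2.ins p.1.1) p.1.1 p.2.1 *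
        deathKernel s ε a φ f (p.1.2.ins p.1.1) p.1.1 p.2.2) :=
    (((measurable_papangelou hφ).comp measurable_fst).ennreal_toReal).mul
      ((hk.comp (hd.prodMk (measurable_fst.fst.prodMk measurable_snd.fst))).mul
        (hk.comp (hd.prodMk (measurable_fst.fst.prodMk measurable_snd.snd))))
  have ham := ha.meas
  have hfm := hf.1.measurable
  have hom := measurable_oneWeight (s := s) (ε := ε) hφ hf
  obtain ⟨h1, h2, h3⟩ := integrable_integral_of_ae_eq (mX := volume) (mY := volume.prod volume)
    (mG := μ) hT (by fun_prop) (h.integrable_oneWeight (ε := ε) ha hf)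
    (Eventually.of_forall fun x => Eventually.of_forall fun y => by
      filter_upwards [h.ae_notMem x, h.ae_energy_ne_top x, h.ae_energy_ne_top (ε⁻¹ • y.1 + x),
        h.ae_energy_ne_top (ε⁻¹ • y.2 + x)] with γ g0 g1 g2 g3
      exact papangelou_mul_deathKernel_sq h.hz.le g0 g1 g2 g3)
  have e : ∀ p : EucSp d × Config d, ∫ y : EucSp d × EucSp d, (papangelou z φ p.1 p.2).toReal *
      (deathKernel s ε a φ f (p.2.ins p.1) p.1 y.1 *
        deathKernel s ε a φ f (p.2.ins p.1) p.1 y.2) ∂(volume.prod volume) =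
      (papangelou z φ p.1 p.2).toReal * deathTerm s ε a φ f (p.2.ins p.1) p.1 ^ 2 := fun p => by
    rw [integral_const_mul, integral_prod_mul, deathTerm, sq]
  simp only [e] at h1 h3
  obtain ⟨h4, h5⟩ := h.gnz.integral_tsum hφ (G := fun γ x => deathTerm s ε a φ f γ x ^ 2)
    ((measurable_deathTerm hφ ham hf).pow_const 2) (fun γ =>
      summable_of_hasFiniteSupport ((finite_support_deathTerm (s := s) (ε := ε) (a := a)
        (φ := φ) hf.2 γ).subset fun x hx h0 =>
        hx (by simp [h0]))) h1
  refine ⟨h4, ?_⟩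
  rw [h5, h3, integral_prod_prod_right h2]
  simp only [integral_const_mul]

lemma Setting.tsum_deathTerm_mul (h : Setting d s z B ξ φ μ k u) (ha : GoodA a) (hf : IsC0 f)
    (hε : 0 < ε) :
    Integrable (fun γ => ∑' p : γ.1 × γ.1, if p.1.1 = p.2.1 then 0 else
      deathTerm s ε a φ f γ p.1.1 * deathTerm s ε a φ f γ p.2.1) μ ∧
      ∫ γ, ∑' p : γ.1 × γ.1, (if p.1.1 = p.2.1 then 0 else
        deathTerm s ε a φ f γ p.1.1 * deathTerm s ε a φ f γ p.2.1) ∂μ =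
        ∫ x₁, ∫ x₂, ∫ y₁, ∫ y₂, z * z * Real.exp (f x₁) * (Real.exp (f x₁) - 1) *
          Real.exp (f x₂) * (Real.exp (f x₂) - 1) * a y₁ * a y₂ *
          (pairWeight s ε φ ((x₁, x₂), (y₁, y₂)) *
            ∫ γ, twoWeight s ε φ f ((x₁, x₂), ((y₁, y₂), γ)) ∂μ) := by
  have := h.prob
  have : NeZero d := ⟨h.hd.ne'⟩
  have hφ := h.pp.meas
  have hd1 := Config.measurable_ins_comp (d := d)
    (Ω := ((EucSp d × EucSp d) × Config d) × (EucSp d × EucSp d))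
    (g := fun p => p.1.2) (x := fun p => p.1.1.2) (by fun_prop) (by fun_prop)
  have hd2 := Config.measurable_ins_comp hd1
    (x := fun p : ((EucSp d × EucSp d) × Config d) × (EucSp d × EucSp d) => p.1.1.1) (by fun_prop)
  have hk := measurable_deathKernel (s := s) (ε := ε) hφ ha.meas hf
  have hT : Measurable fun p : ((EucSp d × EucSp d) × Config d) × (EucSp d × EucSp d) =>
      (papangelou z φ p.1.1.2 p.1.2).toReal *
        ((papangelou z φ p.1.1.1 (p.1.2.ins p.1.1.2)).toReal *
          if p.1.1.1 = p.1.1.2 then 0 else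
            deathKernel s ε a φ f ((p.1.2.ins p.1.1.2).ins p.1.1.1) p.1.1.1 p.2.1 *
            deathKernel s ε a φ f ((p.1.2.ins p.1.1.2).ins p.1.1.1) p.1.1.2 p.2.2) := by
    refine (((measurable_papangelou hφ).comp
      (measurable_fst.fst.snd.prodMk measurable_fst.snd)).ennreal_toReal).mul
      ((((measurable_papangelou hφ).comp
        (measurable_fst.fst.fst.prodMk hd1)).ennreal_toReal).mul
      (Measurable.ite (measurableSet_eq_fun (by fun_prop) (by fun_prop)) measurable_const ?_))
    exact (hk.comp (hd2.prodMk (measurable_fst.fst.fst.prodMk measurable_snd.fst))).mul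
      (hk.comp (hd2.prodMk (measurable_fst.fst.snd.prodMk measurable_snd.snd)))
  have ham := ha.meas
  have hfm := hf.1.measurable
  have hpm := measurable_pairWeight (s := s) (ε := ε) hφ
  have htm := measurable_twoWeight (s := s) (ε := ε) hφ hf
  have hne : ∀ v : EucSp d, ∀ᵐ y ∂(volume : Measure (EucSp d)), y ≠ v := fun v =>
    compl_mem_ae_iff.2 (measure_singleton v)
  have hdiag : ∀ᵐ x : EucSp d × EucSp d ∂(volume.prod volume), x.1 ≠ x.2 := by
    have hm : MeasurableSet {x : EucSp d × EucSp d | x.1 ≠ x.2} :=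
      (measurableSet_eq_fun measurable_fst measurable_snd).compl
    rw [Measure.ae_prod_iff_ae_ae hm]
    exact Eventually.of_forall fun x => (hne x).mono fun y hy => hy.symm
  have hshift : ∀ {x x' y : EucSp d}, y ≠ ε • (x' - x) → ε⁻¹ • y + x ≠ x' := fun {x x' y} hy h' =>
    hy (by rw [← h', add_sub_cancel_right, smul_inv_smul₀ hε.ne'])
  obtain ⟨h1, h2, h3⟩ := integrable_integral_of_ae_eq (mX := volume.prod volume)
    (mY := volume.prod volume) (mG := μ) hT (by fun_prop) (h.integrable_twoWeight (ε := ε) ha hf)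
    (by
      filter_upwards [hdiag] with x hx
      filter_upwards [Measure.quasiMeasurePreserving_fst.ae (hne (ε • (x.2 - x.1))),
        Measure.quasiMeasurePreserving_snd.ae (hne (ε • (x.1 - x.2)))] with y hy1 hy2
      filter_upwards [h.ae_notMem x.1, h.ae_notMem x.2, h.ae_energy_ne_top x.1,
        h.ae_energy_ne_top x.2, h.ae_energy_ne_top (ε⁻¹ • y.1 + x.1),
        h.ae_energy_ne_top (ε⁻¹ • y.2 + x.2)] with γ g1 g2 g3 g4 g5 g6
      simp only [if_neg hx]
      exact papangelou_mul_deathKernel_mul h.pp h.hz.le hf hx g1 g2 (hshift hy1) (hshift hy2)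
        g3 g4 g5 g6)
  have e : ∀ p : (EucSp d × EucSp d) × Config d,
      ∫ y : EucSp d × EucSp d, (papangelou z φ p.1.2 p.2).toReal *
        ((papangelou z φ p.1.1 (p.2.ins p.1.2)).toReal *
          if p.1.1 = p.1.2 then 0 else
            deathKernel s ε a φ f ((p.2.ins p.1.2).ins p.1.1) p.1.1 y.1 *
            deathKernel s ε a φ f ((p.2.ins p.1.2).ins p.1.1) p.1.2 y.2) ∂(volume.prod volume) =
      (papangelou z φ p.1.2 p.2).toReal *
        ((papangelou z φ p.1.1 (p.2.ins p.1.2)).toReal * if p.1.1 = p.1.2 then 0 else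
          deathTerm s ε a φ f ((p.2.ins p.1.2).ins p.1.1) p.1.1 *
          deathTerm s ε a φ f ((p.2.ins p.1.2).ins p.1.1) p.1.2) := fun p => by
    rw [integral_const_mul, integral_const_mul]
    split_ifs
    · simp
    · rw [integral_prod_mul, deathTerm, deathTerm]
  simp only [e] at h1 h3
  have hcm := measurable_deathTerm (s := s) (ε := ε) hφ ham hf
  obtain ⟨h4, h5⟩ := h.gnz.integral_tsum_prod hφ
    (G := fun γ x y => if x = y then 0 else deathTerm s ε a φ f γ x * deathTerm s ε a φ f γ y)
    (Measurable.ite (measurableSet_eq_fun (by fun_prop) (by fun_prop)) measurable_const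
      ((hcm.comp (measurable_fst.prodMk measurable_snd.fst)).mul
        (hcm.comp (measurable_fst.prodMk measurable_snd.snd)))) (fun γ x => if_pos rfl)
    (fun γ => by
      have hs := finite_support_deathTerm (s := s) (ε := ε) (a := a) (φ := φ) hf.2 γ
      refine summable_of_hasFiniteSupport ((hs.prod hs).subset fun p hp => ⟨?_, ?_⟩)
      · exact fun h0 => hp (by simp [h0])
      · exact fun h0 => hp (by simp [h0])) h1
  refine ⟨h4, ?_⟩
  rw [h5, h3, integral_prod_prod_prod h2]
  simp only [integral_const_mul]

end SecondMoment

/-- explicit formula for `∫_Γ (H_ε^- F)² dμ` with `F = e^{⟨f,·⟩}`, `ε > 0`. -/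
theorem statement15 (d : ℕ) (s z B ξ : ℝ) (φ : EucSp d → EReal) (μ : Measure (Config d))
    (k u : ∀ n : ℕ, (Fin n → EucSp d) → ℝ) (hset : Setting d s z B ξ φ μ k u)
    (a : EucSp d → ℝ) (ha : GoodA a)
    (f : EucSp d → ℝ) (hf : IsC0 f) (ε : ℝ) (hε : 0 < ε) :
    ∫ γ, (HepsMinus s (aScaled a ε) φ (fun γ' => Real.exp (cpair f γ')) γ) ^ 2 ∂μ
      = (∫ x : EucSp d, ∫ y₁ : EucSp d, ∫ y₂ : EucSp d,
            z * (Real.exp (f x) - 1) ^ 2 * a y₁ * a y₂ *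
            ∫ γ, rexp (((2 * s - 1 : ℝ) : EReal) * energy φ x γ.1 +
              ((s - 1 : ℝ) : EReal) * energy φ (ε⁻¹ • y₁ + x) γ.1 +
              ((s - 1 : ℝ) : EReal) * energy φ (ε⁻¹ • y₂ + x) γ.1 +
              ((2 * cpair f γ : ℝ) : EReal)) ∂μ)
        + ∫ x₁ : EucSp d, ∫ x₂ : EucSp d, ∫ y₁ : EucSp d, ∫ y₂ : EucSp d,
            z * z * Real.exp (f x₁) * (Real.exp (f x₁) - 1) *
              Real.exp (f x₂) * (Real.exp (f x₂) - 1) * a y₁ * a y₂ *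
              rexp (((2 * s - 1 : ℝ) : EReal) * φ (x₁ - x₂) +
                ((s - 1 : ℝ) : EReal) * φ (ε⁻¹ • y₁ + x₁ - x₂) +
                ((s - 1 : ℝ) : EReal) * φ (ε⁻¹ • y₂ + x₂ - x₁)) *
            ∫ γ, rexp (((s - 1 : ℝ) : EReal) * energy φ x₁ γ.1 +
              ((s - 1 : ℝ) : EReal) * energy φ x₂ γ.1 +
              ((s - 1 : ℝ) : EReal) * energy φ (ε⁻¹ • y₁ + x₁) γ.1 +
              ((s - 1 : ℝ) : EReal) * energy φ (ε⁻¹ • y₂ + x₂) γ.1 +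
              ((2 * cpair f γ : ℝ) : EReal)) ∂μ := by
  obtain ⟨h1, h2⟩ := hset.tsum_deathTerm_sq (ε := ε) ha hf
  obtain ⟨h3, h4⟩ := hset.tsum_deathTerm_mul ha hf hε
  have e : ∀ γ : Config d, (HepsMinus s (aScaled a ε) φ (fun γ' => Real.exp (cpair f γ')) γ) ^ 2 =
      ∑' x : γ.1, deathTerm s ε a φ f γ x.1 ^ 2 +
        ∑' p : γ.1 × γ.1, if p.1.1 = p.2.1 then 0 else
          deathTerm s ε a φ f γ p.1.1 * deathTerm s ε a φ f γ p.2.1 := fun γ => by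
    rw [HepsMinus_aScaled_exp hε ha.even hf.2,
      sq_tsum_eq_of_finite_support (finite_support_deathTerm hf.2 γ)]
    simp only [Subtype.ext_iff]
  simp only [e]
  rw [integral_add h1 h3, h2, h4]
  simp only [oneWeight, pairWeight, twoWeight, mul_assoc]

end
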